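/- arXiv:1805.10894 — 5 statements merged into one kernel-verified Lean document; each statement's English description precedes it below -/
import Mathlib

section
/- For every n ≥ 3, every element g of the intersection R_0 ∩ R_1 ∩ ⋯ ∩ R_n satisfies g − 1 ∈ (r_0, …, r_n)_Σ in the integral group ring ℤF; that is, R_0 ∩ ⋯ ∩ R_n ⊆ F ∩ (1 + (r_0, …, r_n)_Σ). -/
/-- The elements `x_0, …, x_n` of the free group `F` on `x_0, …, x_{n-1}`, with
`x_n := (x_0 ⋯ x_{n-1})⁻¹`, so that `x_0 x_1 ⋯ x_n = 1`. -/
def xF (n : ℕ) (i : Fin (n + 1)) : FreeGroup (Fin n) :=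
  if h : (i : ℕ) < n then FreeGroup.of ⟨i, h⟩
  else ((List.ofFn fun j : Fin n => FreeGroup.of j).prod)⁻¹

/-- `R_i`, the normal closure of `x_i` in `F`. -/
def RSub (n : ℕ) (i : Fin (n + 1)) : Subgroup (FreeGroup (Fin n)) :=
  Subgroup.normalClosure {xF n i}

/-- `r_i = (R_i - 1)ℤF`, the two-sided ideal of `ℤF` generated by
`{g - 1 : g ∈ R_i}`, viewed as a `ℤ`-submodule of the group ring. -/
noncomputable def rIdeal (n : ℕ) (i : Fin (n + 1)) :
    Submodule ℤ (MonoidAlgebra ℤ (FreeGroup (Fin n))) :=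
  Submodule.span ℤ
    {v | ∃ (a b : MonoidAlgebra ℤ (FreeGroup (Fin n))) (g : FreeGroup (Fin n)),
      g ∈ RSub n i ∧ v = a * ((MonoidAlgebra.of ℤ (FreeGroup (Fin n)) g) - 1) * b}

/-- The symmetric product `(r_0, …, r_n)_Σ = Σ_ρ r_{ρ(0)} ⋯ r_{ρ(n)}`. -/
noncomputable def symProd (n : ℕ) : Submodule ℤ (MonoidAlgebra ℤ (FreeGroup (Fin n))) :=
  ⨆ ρ : Equiv.Perm (Fin (n + 1)),
    (List.ofFn fun k : Fin (n + 1) => rIdeal n (ρ k)).prod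

namespace SymP

abbrev FG (n : ℕ) := FreeGroup (Fin n)
abbrev GA (n : ℕ) := MonoidAlgebra ℤ (FreeGroup (Fin n))

noncomputable def o {n : ℕ} (g : FG n) : GA n := MonoidAlgebra.of ℤ (FreeGroup (Fin n)) g

theorem o_mul {n : ℕ} (g h : FG n) : o (g * h) = o g * o h := map_mul _ _ _
theorem o_one {n : ℕ} : o (1 : FG n) = 1 := map_one _

theorem xF_castSucc {n : ℕ} (j : Fin n) : xF n j.castSucc = FreeGroup.of j := by
  simp [xF]

theorem xF_last {n : ℕ} :
    xF n (Fin.last n) = ((List.ofFn fun j : Fin n => FreeGroup.of j).prod)⁻¹ := by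
  simp [xF]

theorem xF_prod (n : ℕ) : (List.ofFn (xF n)).prod = 1 := by
  rw [List.ofFn_succ', List.concat_eq_append, List.prod_append]
  simp [xF_castSucc, xF_last]

/-- dependence of the product on one coordinate -/
theorem prod_update {H : Type*} [Group H] : ∀ (n : ℕ) (f : Fin n → H) (k : Fin n),
    ∃ P Q : H, ∀ h, (List.ofFn (Function.update f k h)).prod = P * h * Q := by
  intro n
  induction n with
  | zero => intro f k; exact k.elim0
  | succ n ih =>
    intro f k
    refine Fin.cases ?_ ?_ k
    · refine ⟨1, (List.ofFn fun i : Fin n => f i.succ).prod, fun h => ?_⟩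
      simp [List.ofFn_succ, Function.update]
    · intro k
      obtain ⟨P, Q, h⟩ := ih (fun i => f i.succ) k
      refine ⟨f 0 * P, Q, fun a => ?_⟩
      have h2 := h a
      have h3 : (fun i : Fin n => Function.update f k.succ a i.succ)
          = Function.update (fun i => f i.succ) k a := by
        funext i
        simp [Function.update, Fin.succ_inj]
      rw [List.ofFn_succ, List.prod_cons, h3, h2]
      simp [Function.update, mul_assoc, (Fin.succ_ne_zero k).symm]

theorem hom_of {H : Type*} [Group H] {n : ℕ} (f : Fin (n + 1) → H)
    (hf : (List.ofFn f).prod = 1) : ∃ φ : FG n →* H, ∀ i, φ (xF n i) = f i := by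
  refine ⟨FreeGroup.lift fun j => f j.castSucc, fun i => ?_⟩
  rw [List.ofFn_succ', List.concat_eq_append, List.prod_append] at hf
  refine Fin.lastCases ?_ (fun j => ?_) i
  · rw [xF_last, map_inv, map_list_prod, List.map_ofFn]
    simp only [List.prod_cons, List.prod_nil, mul_one] at hf
    rw [inv_eq_iff_mul_eq_one]
    have e : ((FreeGroup.lift fun j : Fin n => f j.castSucc) ∘ fun j => FreeGroup.of j)
        = fun j : Fin n => f j.castSucc := by
      funext j; simp
    have e' := congrArg (fun u => (List.ofFn u).prod * f (Fin.last n)) e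
    exact e'.trans hf
  · simp [xF_castSucc]

noncomputable def gaMap {n m : ℕ} (φ : FG n →* FG m) : GA n →ₐ[ℤ] GA m :=
  MonoidAlgebra.lift ℤ (GA m) (FG n) ((MonoidAlgebra.of ℤ (FG m)).comp φ)

theorem gaMap_o {n m : ℕ} (φ : FG n →* FG m) (g : FG n) : gaMap φ (o g) = o (φ g) := by
  simp [gaMap, o]

theorem span_o {n : ℕ} {P : GA n → Prop} (z : GA n) (hg : ∀ g, P (o g))
    (ha : ∀ x y, P x → P y → P (x + y)) (hs : ∀ (c : ℤ) x, P x → P (c • x)) : P z :=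
  MonoidAlgebra.induction_on z hg ha hs

/-! ### the ideals -/

noncomputable abbrev X {n : ℕ} (i : Fin (n + 1)) : GA n := o (xF n i) - 1

theorem r_mem {n : ℕ} {i : Fin (n + 1)} {g : FG n} (hg : g ∈ RSub n i) (a b : GA n) :
    a * (o g - 1) * b ∈ rIdeal n i := Submodule.subset_span ⟨a, b, g, hg, rfl⟩

theorem X_mem {n : ℕ} (i : Fin (n + 1)) (a b : GA n) : a * X i * b ∈ rIdeal n i :=
  r_mem (Subgroup.subset_normalClosure rfl) a b

theorem r_mul_left {n : ℕ} {i : Fin (n + 1)} (a : GA n) {z : GA n} (hz : z ∈ rIdeal n i) :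
    a * z ∈ rIdeal n i := by
  unfold rIdeal at hz
  induction hz using Submodule.span_induction with
  | mem x h =>
    obtain ⟨b, c, g, hg, rfl⟩ := h
    rw [← mul_assoc, ← mul_assoc]
    exact r_mem hg _ _
  | zero => simp
  | add x y _ _ hx hy => rw [mul_add]; exact add_mem hx hy
  | smul c x _ hx => rw [mul_smul_comm]; exact Submodule.smul_mem _ _ hx

theorem r_mul_right {n : ℕ} {i : Fin (n + 1)} (a : GA n) {z : GA n} (hz : z ∈ rIdeal n i) :
    z * a ∈ rIdeal n i := by
  unfold rIdeal at hz
  induction hz using Submodule.span_induction with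
  | mem x h =>
    obtain ⟨b, c, g, hg, rfl⟩ := h
    rw [mul_assoc]
    exact r_mem hg _ _
  | zero => simp
  | add x y _ _ hx hy => rw [add_mul]; exact add_mem hx hy
  | smul c x _ hx => rw [smul_mul_assoc]; exact Submodule.smul_mem _ _ hx

theorem r_le {n : ℕ} {i : Fin (n + 1)} (N : Submodule ℤ (GA n))
    (h : ∀ a b : GA n, a * X i * b ∈ N) : rIdeal n i ≤ N := by
  have key : ∀ g ∈ RSub n i, ∀ a b : GA n, a * (o g - 1) * b ∈ N := by
    intro g hg
    unfold RSub Subgroup.normalClosure at hg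
    induction hg using Subgroup.closure_induction with
    | mem x hx =>
      intro a b
      simp only [Group.mem_conjugatesOfSet_iff, Set.mem_singleton_iff, exists_eq_left] at hx
      obtain ⟨c, hc⟩ := isConj_iff.1 hx
      have : a * (o x - 1) * b = (a * o c) * X i * (o c⁻¹ * b) := by
        have h1 : o c * o c⁻¹ = (1 : GA n) := by rw [← o_mul, mul_inv_cancel, o_one]
        rw [← hc, o_mul, o_mul]
        calc _ = a * (o c * o (xF n i) * o c⁻¹ - o c * o c⁻¹) * b := by rw [h1]
          _ = _ := by noncomm_ring
      rw [this]; exact h _ _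
    | one => intro a b; simp [o_one]
    | mul x y _ _ hx hy =>
      intro a b
      have : a * (o (x * y) - 1) * b = a * (o x - 1) * (o y * b) + a * (o y - 1) * b := by
        rw [o_mul]; noncomm_ring
      rw [this]; exact add_mem (hx _ _) (hy _ _)
    | inv x _ hx =>
      intro a b
      have h1 : o x⁻¹ * o x = (1 : GA n) := by rw [← o_mul, inv_mul_cancel, o_one]
      have : a * (o x⁻¹ - 1) * b = -((a * o x⁻¹) * (o x - 1) * b) := by
        calc _ = a * (o x⁻¹ - o x⁻¹ * o x) * b := by rw [h1]
          _ = _ := by noncomm_ring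
      rw [this]; exact neg_mem (hx _ _)
  unfold rIdeal
  rw [Submodule.span_le]
  rintro v ⟨a, b, g, hg, rfl⟩
  exact key g hg a b

theorem r_ker {n : ℕ} {i : Fin (n + 1)} {B : Type*} [Ring B] (φ : GA n →+* B)
    (h : φ (X i) = 0) {z : GA n} (hz : z ∈ rIdeal n i) : φ z = 0 := by
  have := r_le (i := i) (LinearMap.ker φ.toAddMonoidHom.toIntLinearMap) (fun a b => by
    change φ _ = 0
    simp only [map_mul, h, mul_zero, zero_mul])
  exact this hz

theorem r_map {n m : ℕ} {i : Fin (n + 1)} {j : Fin (m + 1)} (φ : GA n →ₐ[ℤ] GA m)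
    (h : φ (X i) = X j) {z : GA n} (hz : z ∈ rIdeal n i) : φ z ∈ rIdeal m j := by
  have := r_le (i := i) ((rIdeal m j).comap φ.toLinearMap) (fun a b => by
    simp only [Submodule.mem_comap, AlgHom.toLinearMap_apply, map_mul, h]
    exact X_mem _ _ _)
  exact this hz

theorem r_surj {n m : ℕ} {i : Fin (n + 1)} {j : Fin (m + 1)} (φ : GA n →ₐ[ℤ] GA m)
    (hs : Function.Surjective φ)
    (h : φ (X i) = X j) : rIdeal m j ≤ (rIdeal n i).map φ.toLinearMap := by
  refine r_le _ fun a b => ?_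
  obtain ⟨a, rfl⟩ := hs a
  obtain ⟨b, rfl⟩ := hs b
  exact ⟨a * X i * b, X_mem _ _ _, by simp only [AlgHom.toLinearMap_apply, map_mul, h]⟩

theorem exists_e {n : ℕ} (k i : Fin (n + 1)) (hki : k ≠ i) :
    ∃ e : GA n →ₐ[ℤ] GA n, (∀ j, j ≠ i → j ≠ k → e (o (xF n j)) = o (xF n j)) ∧
      e (o (xF n i)) = 1 ∧ ∀ t, t - e t ∈ rIdeal n i := by
  obtain ⟨P, Q, hPQ⟩ := prod_update (n + 1) (Function.update (xF n) i 1) k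
  obtain ⟨φ, hφ⟩ := hom_of (Function.update (Function.update (xF n) i 1) k (P⁻¹ * Q⁻¹))
    (by rw [hPQ]; group)
  have h1 : φ (xF n i) = 1 := by rw [hφ]; simp [Function.update, hki.symm]
  have h2 : ∀ j, j ≠ i → j ≠ k → φ (xF n j) = xF n j := by
    intro j h1 h2; rw [hφ]; simp [Function.update, h1, h2]
  have : (RSub n i).Normal := Subgroup.normalClosure_normal
  let q : FG n →* FG n ⧸ RSub n i := QuotientGroup.mk' _
  have hqi : q (xF n i) = 1 :=
    (QuotientGroup.eq_one_iff _).2 (Subgroup.subset_normalClosure rfl)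
  have h3 : ∀ j, j ≠ k → q (φ (xF n j)) = q (xF n j) := by
    intro j hj
    by_cases hji : j = i
    · subst hji; rw [h1, hqi, map_one]
    · rw [h2 j hji hj]
  have hk : q (φ (xF n k)) = q (xF n k) := by
    obtain ⟨P', Q', hPQ'⟩ := prod_update (n + 1) (fun j => q (xF n j)) k
    have e1 := hPQ' (q (xF n k))
    have e2 := hPQ' (q (φ (xF n k)))
    have s1 : Function.update (fun j => q (xF n j)) k (q (xF n k)) = fun j => q (xF n j) := by
      simp
    have s2 : Function.update (fun j => q (xF n j)) k (q (φ (xF n k)))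
        = fun j => (q.comp φ) (xF n j) := by
      funext j
      by_cases hj : j = k
      · subst hj; simp
      · simp [Function.update, hj, h3 j hj]
    have p : ∀ ψ : FG n →* FG n ⧸ RSub n i,
        (List.ofFn fun j => ψ (xF n j)).prod = 1 := by
      intro ψ
      have := congrArg ψ (xF_prod n)
      rwa [map_list_prod, List.map_ofFn, map_one] at this
    rw [s1, p q] at e1
    rw [s2, p] at e2
    have := e1.symm.trans e2
    simpa using this.symm
  have hq : q.comp φ = q := by
    apply FreeGroup.ext_hom
    intro j
    rw [← xF_castSucc]
    by_cases hj : j.castSucc = k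
    · rw [hj]; exact hk
    · exact h3 _ hj
  refine ⟨gaMap φ, fun j a b => by rw [gaMap_o, h2 j a b], by rw [gaMap_o, h1, o_one], fun t => ?_⟩
  refine span_o (P := fun t => t - gaMap φ t ∈ rIdeal n i) t (fun g => ?_) (fun x y hx hy => ?_) (fun c x hx => ?_)
  · have : (φ g)⁻¹ * g ∈ RSub n i := by
      rw [← QuotientGroup.eq]
      exact DFunLike.congr_fun hq g
    have h := r_mem this (o (φ g)) 1
    have e : o (φ g) * (o ((φ g)⁻¹ * g) - 1) * 1 = o g - gaMap φ (o g) := by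
      rw [gaMap_o, mul_one, mul_sub, ← o_mul, mul_one, mul_inv_cancel_left]
    rwa [e] at h
  · have : x + y - gaMap φ (x + y) = (x - gaMap φ x) + (y - gaMap φ y) := by rw [map_add]; abel
    rw [this]; exact add_mem hx hy
  · rw [map_smul, ← smul_sub]; exact Submodule.smul_mem _ _ hx

/-! ### symmetric products over lists -/

noncomputable def PL (n : ℕ) (L : List (Fin (n + 1))) : Submodule ℤ (GA n) :=
  (L.map (rIdeal n)).prod

noncomputable def SymL (n : ℕ) (S : List (Fin (n + 1))) : Submodule ℤ (GA n) :=
  ⨆ L : {L : List (Fin (n + 1)) // L.Perm S}, PL n L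

theorem SymL_congr {n : ℕ} {S T : List (Fin (n + 1))} (h : S.Perm T) : SymL n S = SymL n T := by
  apply le_antisymm
  · exact iSup_le fun L => le_iSup_of_le ⟨L.1, L.2.trans h⟩ le_rfl
  · exact iSup_le fun L => le_iSup_of_le ⟨L.1, L.2.trans h.symm⟩ le_rfl

theorem PL_le {n : ℕ} {L S : List (Fin (n + 1))} (h : L.Perm S) : PL n L ≤ SymL n S :=
  le_iSup_of_le ⟨L, h⟩ le_rfl

theorem r_mul_SymL {n : ℕ} (i : Fin (n + 1)) (S : List (Fin (n + 1))) :
    rIdeal n i * SymL n S ≤ SymL n (i :: S) := by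
  unfold SymL
  rw [Submodule.mul_iSup]
  refine iSup_le fun L => ?_
  have : rIdeal n i * PL n L.1 = PL n (i :: L.1) := by simp [PL]
  rw [this]
  exact PL_le (L.2.cons i)

theorem r_sub {n : ℕ} (i j : Fin (n + 1)) (e : GA n →ₐ[ℤ] GA n)
    (hj : e (X j) = X j) (he : ∀ t, t - e t ∈ rIdeal n i) {u : GA n} (hu : u ∈ rIdeal n j) :
    u - e u ∈ rIdeal n i * rIdeal n j ⊔ rIdeal n j * rIdeal n i := by
  have := r_le (i := j) ((rIdeal n i * rIdeal n j ⊔ rIdeal n j * rIdeal n i).comap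
    (LinearMap.id - e.toLinearMap)) (fun a b => by
      simp only [Submodule.mem_comap, LinearMap.sub_apply, LinearMap.id_apply,
        AlgHom.toLinearMap_apply, map_mul, hj]
      have : a * X j * b - e a * X j * e b =
        (a - e a) * (1 * X j * b) + (e a * X j * 1) * (b - e b) := by noncomm_ring
      rw [this]
      exact Submodule.add_mem_sup (Submodule.mul_mem_mul (he _) (X_mem _ _ _))
        (Submodule.mul_mem_mul (X_mem _ _ _) (he _)))
  exact this hu

theorem PL_sub {n : ℕ} (i k : Fin (n + 1)) (e : GA n →ₐ[ℤ] GA n)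
    (hj : ∀ j, j ≠ i → j ≠ k → e (X j) = X j) (he : ∀ t, t - e t ∈ rIdeal n i)
    (L : List (Fin (n + 1))) (hi : i ∉ L) (hk : k ∉ L) :
    ∀ t ∈ PL n L, t - e t ∈ SymL n (i :: L) := by
  induction L with
  | nil =>
    intro t ht
    simp only [PL, List.map_nil, List.prod_nil] at ht
    obtain ⟨c, rfl⟩ := Submodule.mem_one.1 ht
    simp
  | cons j L ih =>
    simp only [List.mem_cons, not_or] at hi hk
    have ih := ih hi.2 hk.2
    have hj' := hj j (Ne.symm hi.1) (Ne.symm hk.1)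
    intro t ht
    have e1 : PL n (j :: L) = rIdeal n j * PL n L := by simp [PL]
    rw [e1] at ht
    refine Submodule.mul_induction_on ht (fun u hu v hv => ?_) (fun x y hx hy => ?_)
    · have : u * v - e (u * v) = (u - e u) * v + e u * (v - e v) := by
        rw [map_mul]; noncomm_ring
      rw [this]
      refine add_mem ?_ ?_
      · have h1 := Submodule.mul_mem_mul (r_sub i j e hj' he hu) hv
        rw [Submodule.sup_mul] at h1
        refine (sup_le ?_ ?_ : _ ≤ SymL n (i :: j :: L)) h1
        · have : rIdeal n i * rIdeal n j * PL n L = PL n (i :: j :: L) := by simp [PL, mul_assoc]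
          rw [this]; exact PL_le (List.Perm.refl _)
        · have : rIdeal n j * rIdeal n i * PL n L = PL n (j :: i :: L) := by simp [PL, mul_assoc]
          rw [this]; exact PL_le (List.Perm.swap _ _ _)
      · have h1 := r_mul_SymL j (i :: L) (Submodule.mul_mem_mul (r_map e hj' hu) (ih v hv))
        rwa [SymL_congr (List.Perm.swap i j L)] at h1
    · have : x + y - e (x + y) = (x - e x) + (y - e y) := by rw [map_add]; abel
      rw [this]; exact add_mem hx hy

theorem SymL_sub {n : ℕ} (i k : Fin (n + 1)) (e : GA n →ₐ[ℤ] GA n)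
    (hj : ∀ j, j ≠ i → j ≠ k → e (X j) = X j) (he : ∀ t, t - e t ∈ rIdeal n i)
    (S : List (Fin (n + 1))) (hi : i ∉ S) (hk : k ∉ S) :
    ∀ t ∈ SymL n S, t - e t ∈ SymL n (i :: S) := by
  have : SymL n S ≤ (SymL n (i :: S)).comap (LinearMap.id - e.toLinearMap) := by
    refine iSup_le fun L t ht => ?_
    have h := PL_sub i k e hj he L.1 (fun h => hi (L.2.subset h)) (fun h => hk (L.2.subset h)) t ht
    rw [SymL_congr (L.2.cons i)] at h
    exact h
  exact fun t ht => this ht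

/-- Key lemma: an intersection missing the index `k` is a symmetric product. -/
theorem inter_le {n : ℕ} (k : Fin (n + 1)) (S : List (Fin (n + 1))) (hS : S.Nodup) (hk : k ∉ S)
    (hne : S ≠ []) (z : GA n) (hz : ∀ i ∈ S, z ∈ rIdeal n i) : z ∈ SymL n S := by
  induction S with
  | nil => exact absurd rfl hne
  | cons i S ih =>
    by_cases h : S = []
    · subst h
      have := hz i (by simp)
      have h2 : PL n [i] ≤ SymL n [i] := PL_le (List.Perm.refl _)
      apply h2; simpa [PL] using this
    · simp only [List.nodup_cons, List.mem_cons, not_or] at hS hk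
      have h1 := ih hS.2 hk.2 h (fun j hj => hz j (List.mem_cons_of_mem _ hj))
      obtain ⟨e, e1, e2, e3⟩ := exists_e k i hk.1
      have h2 := SymL_sub i k e (fun j a b => by rw [map_sub, e1 j a b, map_one]) e3 S hS.1 hk.2 z h1
      have h3 : e z = 0 := r_ker e.toRingHom
        (by change e _ = 0; rw [map_sub, e2, map_one, sub_self]) (hz i (by simp))
      rwa [h3, sub_zero] at h2

theorem SymL_surj {n m : ℕ} (φ : GA n →ₐ[ℤ] GA m) (hs : Function.Surjective φ)
    (f : Fin (m + 1) → Fin (n + 1)) (hf : ∀ j, φ (X (f j)) = X j) (S : List (Fin (m + 1))) :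
    SymL m S ≤ (SymL n (S.map f)).map φ.toLinearMap := by
  refine iSup_le fun L => ?_
  have : PL m L ≤ (PL n (L.1.map f)).map φ.toLinearMap := by
    generalize L.1 = L
    induction L with
    | nil => simp [PL, Submodule.map_one]
    | cons j L ih =>
      have e1 : PL m (j :: L) = rIdeal m j * PL m L := by simp [PL]
      have e2 : PL n ((j :: L).map f) = rIdeal n (f j) * PL n (L.map f) := by simp [PL]
      rw [e1, e2, Submodule.map_mul]
      exact mul_le_mul' (r_surj φ hs (hf j)) ih
  exact this.trans (Submodule.map_mono (PL_le (L.2.map f)))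

theorem SymL_le_symProd (n : ℕ) : SymL n (List.finRange (n + 1)) ≤ symProd n := by
  refine iSup_le fun L => ?_
  obtain ⟨L, hL⟩ := L
  have hn : L.Nodup := hL.nodup_iff.2 (List.nodup_finRange _)
  have hl : L.length = n + 1 := by simpa using hL.length_eq
  let f : Fin (n + 1) → Fin (n + 1) := fun k => L.get (k.cast hl.symm)
  have hf : Function.Injective f := by
    intro a b h
    have := (List.nodup_iff_injective_get.1 hn) h
    simpa using this
  let ρ : Equiv.Perm (Fin (n + 1)) := Equiv.ofBijective f (Finite.injective_iff_bijective.1 hf)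
  refine le_iSup_of_le ρ (le_of_eq ?_)
  unfold PL
  congr 1
  apply List.ext_get
  · simp [hl]
  · intro a h1 h2
    rw [List.get_ofFn]
    simp [ρ, f]
    rfl

end SymP

namespace SymP

/-! ### Fox derivatives -/

noncomputable def Mu {n : ℕ} (l j : Fin n) : (Matrix (Fin 2) (Fin 2) (GA n))ˣ where
  val := !![1, if j = l then 1 else 0; 0, o (FreeGroup.of j)]
  inv := !![1, if j = l then - o (FreeGroup.of j)⁻¹ else 0; 0, o (FreeGroup.of j)⁻¹]
  val_inv := by
    have h : o (FreeGroup.of j) * o (FreeGroup.of j)⁻¹ = (1 : GA n) := by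
      rw [← o_mul, mul_inv_cancel, o_one]
    ext a b
    fin_cases a <;> fin_cases b <;> simp [Matrix.mul_apply, Fin.sum_univ_two, h] <;>
      split_ifs <;> simp
  inv_val := by
    have h : o (FreeGroup.of j)⁻¹ * o (FreeGroup.of j) = (1 : GA n) := by
      rw [← o_mul, inv_mul_cancel, o_one]
    ext a b
    fin_cases a <;> fin_cases b <;> simp [Matrix.mul_apply, Fin.sum_univ_two, h] <;>
      split_ifs <;> simp [h]

noncomputable def Dm {n : ℕ} (l : Fin n) : FG n →* Matrix (Fin 2) (Fin 2) (GA n) :=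
  (Units.coeHom _).comp (FreeGroup.lift (Mu l))

noncomputable def DD {n : ℕ} (l : Fin n) : GA n →ₐ[ℤ] Matrix (Fin 2) (Fin 2) (GA n) :=
  MonoidAlgebra.lift ℤ _ (FG n) (Dm l)

theorem DD_o {n : ℕ} (l : Fin n) (g : FG n) : DD l (o g) = Dm l g := by
  simp [DD, o]

noncomputable def d {n : ℕ} (l : Fin n) : GA n →ₗ[ℤ] GA n :=
  (Matrix.entryLinearMap ℤ (GA n) 0 1).comp (DD l).toLinearMap

theorem d_apply {n : ℕ} (l : Fin n) (z : GA n) : d l z = DD l z 0 1 := rfl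

theorem Dm_entries {n : ℕ} (l : Fin n) (g : FG n) :
    Dm l g 0 0 = 1 ∧ Dm l g 1 0 = 0 ∧ Dm l g 1 1 = o g := by
  induction g using FreeGroup.induction_on with
  | C1 => simp [o_one]
  | of j => simp [Dm, Mu]
  | inv_of j _ => simp [Dm, Mu, -Matrix.coe_units_inv, Units.inv]
  | mul x y hx hy => 
    simp [Matrix.mul_apply, Fin.sum_univ_two, hx, hy, o_mul]

theorem DD_11 {n : ℕ} (l : Fin n) (z : GA n) : DD l z 1 1 = z := by
  refine span_o (P := fun z => DD l z 1 1 = z) z (fun g => ?_) (fun x y hx hy => ?_)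
    (fun c x hx => ?_)
  · rw [DD_o]; exact (Dm_entries l g).2.2
  · rw [map_add, Matrix.add_apply, hx, hy]
  · rw [map_smul, Matrix.smul_apply, hx]

theorem d_omul {n : ℕ} (l : Fin n) (g : FG n) (w : GA n) :
    d l (o g * w) = d l (o g) * w + d l w := by
  simp only [d_apply, map_mul, Matrix.mul_apply, Fin.sum_univ_two, DD_11]
  rw [DD_o, (Dm_entries l g).1, one_mul, add_comm]

theorem d_one {n : ℕ} (l : Fin n) : d l 1 = 0 := by
  simp [d_apply]

theorem d_of {n : ℕ} (l j : Fin n) : d l (o (FreeGroup.of j)) = if j = l then 1 else 0 := by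
  rw [d_apply, DD_o]; simp [Dm, Mu]

theorem d_of_inv {n : ℕ} (l j : Fin n) :
    d l (o (FreeGroup.of j)⁻¹) = if j = l then - o (FreeGroup.of j)⁻¹ else 0 := by
  have h := d_omul l (FreeGroup.of j) (o (FreeGroup.of j)⁻¹)
  rw [← o_mul, mul_inv_cancel, o_one, d_one, d_of] at h
  rw [eq_neg_of_add_eq_zero_right h.symm]
  split_ifs <;> simp

theorem d_Xmul {n : ℕ} (l : Fin n) (g : FG n) (w : GA n) :
    d l ((o g - 1) * w) = d l (o g) * w := by
  rw [sub_mul, map_sub, d_omul, one_mul, add_sub_cancel_right]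

theorem fox_g {n : ℕ} (g : FG n) :
    o g = 1 + ∑ l, (o (FreeGroup.of l) - 1) * d l (o g) := by
  induction g using FreeGroup.induction_on with
  | C1 => simp [o_one, d_one]
  | of j => simp [d_of]
  | inv_of j _ =>
    simp only [d_of_inv]
    simp [sub_mul, ← o_mul, o_one]
  | mul x y hx hy =>
    rw [o_mul]
    simp only [d_omul, mul_add, Finset.sum_add_distrib, ← mul_assoc, ← Finset.sum_mul]
    rw [← sub_eq_iff_eq_add'] at hx hy
    rw [← hx, ← hy]
    noncomm_ring

noncomputable def eps (n : ℕ) : GA n →ₐ[ℤ] GA n := gaMap 1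

theorem eps_o {n : ℕ} (g : FG n) : eps n (o g) = 1 := by
  rw [eps, gaMap_o, MonoidHom.one_apply, o_one]

theorem fox {n : ℕ} (z : GA n) :
    z = eps n z + ∑ l, (o (FreeGroup.of l) - 1) * d l z := by
  refine span_o (P := fun z => z = eps n z + ∑ l, (o (FreeGroup.of l) - 1) * d l z) z
    (fun g => ?_) (fun x y hx hy => ?_) (fun c x hx => ?_)
  · rw [eps_o]; exact fox_g g
  · simp only [map_add, mul_add, Finset.sum_add_distrib]
    nth_rw 1 [hx]
    nth_rw 1 [hy]
    abel
  · simp only [map_smul, mul_smul_comm, ← Finset.smul_sum]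
    rw [← smul_add, ← hx]

theorem eps_r {n : ℕ} {i : Fin (n + 1)} {z : GA n} (hz : z ∈ rIdeal n i) : eps n z = 0 :=
  r_ker (eps n).toRingHom (by change eps n _ = 0; rw [map_sub, eps_o, map_one, sub_self]) hz

/-- chain rule -/
theorem chain {n m : ℕ} (φ : GA n →ₐ[ℤ] GA m) (f : Fin n → FG m)
    (hφ : ∀ j, φ (o (FreeGroup.of j)) = o (f j)) (l : Fin m) (z : GA n) (hz : eps n z = 0) :
    d l (φ z) = ∑ j, d l (o (f j)) * φ (d j z) := by
  have h := fox z
  rw [hz, zero_add] at h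
  conv_lhs => rw [h]
  simp only [map_sum, map_mul, map_sub, map_one, hφ, d_Xmul]

theorem d_r {n : ℕ} {i l : Fin n} (hl : l ≠ i) {z : GA n} (hz : z ∈ rIdeal n i.castSucc) :
    d l z ∈ rIdeal n i.castSucc := by
  obtain ⟨e, e1, e2, e3⟩ := exists_e (Fin.last n) i.castSucc (Fin.castSucc_lt_last i).ne'
  have h1 : ∀ j, e (o (FreeGroup.of j)) = o (if j = i then 1 else FreeGroup.of j) := by
    intro j
    by_cases h : j = i
    · subst h; rw [← xF_castSucc, e2, if_pos rfl, o_one]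
    · rw [if_neg h, ← xF_castSucc, e1 _ (by simpa using h) (Fin.castSucc_lt_last j).ne]
  have h2 := chain e _ h1 l z (eps_r hz)
  have h3 : e z = 0 := r_ker e.toRingHom
        (by change e _ = 0; rw [map_sub, e2, map_one, sub_self]) hz
  rw [h3, map_zero, Finset.sum_eq_single l] at h2
  · rw [if_neg hl, d_of, if_pos rfl, one_mul] at h2
    have := e3 (d l z)
    rwa [← h2, sub_zero] at this
  · intro j _ hj
    split_ifs
    · rw [o_one, d_one, zero_mul]
    · rw [d_of, if_neg hj, zero_mul]
  · simp

/-! ### the elements T -/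
noncomputable def T {n : ℕ} (l : Fin (n + 1)) : FG n := (Fin.partialProd FreeGroup.of l)⁻¹

theorem T_zero {n : ℕ} : T (0 : Fin (n + 1)) = 1 := by simp [T]

theorem T_succ {n : ℕ} (j : Fin n) : T j.succ = (FreeGroup.of j)⁻¹ * T j.castSucc := by
  simp [T, Fin.partialProd_succ]

theorem T_last {n : ℕ} : T (Fin.last n) = xF n (Fin.last n) := by
  rw [xF_last, T, Fin.partialProd]
  congr 2
  simp

theorem d_T {n : ℕ} (l : Fin n) (j : Fin (n + 1)) :
    d l (o (T j)) = if l.castSucc < j then - o (T l.succ) else 0 := by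
  induction j using Fin.induction with
  | zero => simp [T_zero, o_one, d_one]
  | succ j ih =>
    rw [T_succ, o_mul, d_omul, ih, d_of_inv]
    by_cases h : j = l
    · subst h
      simp [T_succ, o_mul]
    · rw [if_neg h, zero_mul, zero_add]
      congr 1
      have : (l : ℕ) ≠ j := fun h' => h (Fin.ext h'.symm)
      simp only [Fin.lt_def, Fin.val_castSucc, Fin.val_succ, eq_iff_iff]
      omega

noncomputable def V {n : ℕ} (l : Fin n) : GA n := o (T l.castSucc) - o (T l.succ)

theorem V_eq {n : ℕ} (l : Fin n) : V l = X l.castSucc * o (T l.succ) := by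
  rw [V, X, xF_castSucc, sub_mul, one_mul, ← o_mul, T_succ, mul_inv_cancel_left]

theorem V_mem {n : ℕ} (l : Fin n) : V l ∈ rIdeal n l.castSucc := by
  rw [V_eq, ← one_mul (X _)]; exact X_mem _ _ _

theorem V_sum (n : ℕ) : ∑ l : Fin n, V l = - X (Fin.last n) := by
  have : ∀ u : Fin (n + 1) → GA n, ∑ l : Fin n, (u l.castSucc - u l.succ) = u 0 - u (Fin.last n) := by
    intro u
    rw [Finset.sum_sub_distrib]
    have h1 := Fin.sum_univ_succ u
    have h2 := Fin.sum_univ_castSucc u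
    rw [h1] at h2
    rw [sub_eq_sub_iff_add_eq_add, ← h2.symm.trans rfl]
  have := this (fun l => o (T l))
  simp only [V]
  rw [this, T_zero, o_one, T_last, X, neg_sub]

end SymP

namespace SymP

theorem sub_gaMap_mem {n : ℕ} {i : Fin (n + 1)} (φ : FG n →* FG n)
    (h : ∀ j, o (FreeGroup.of j) - o (φ (FreeGroup.of j)) ∈ rIdeal n i) (t : GA n) :
    t - gaMap φ t ∈ rIdeal n i := by
  refine span_o (P := fun t => t - gaMap φ t ∈ rIdeal n i) t (fun g => ?_)
    (fun x y hx hy => ?_) (fun c x hx => ?_)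
  · rw [gaMap_o]
    induction g using FreeGroup.induction_on with
    | C1 => simp
    | of j => exact h j
    | inv_of j hj =>
      have : o (FreeGroup.of j)⁻¹ - o (φ (FreeGroup.of j)⁻¹) =
          -(o (φ (FreeGroup.of j)⁻¹) * ((o (FreeGroup.of j) - o (φ (FreeGroup.of j)))
            * o (FreeGroup.of j)⁻¹)) := by
        rw [sub_mul, mul_sub, ← o_mul, ← o_mul, ← o_mul, ← o_mul, map_inv]
        simp
      exact this ▸ neg_mem (r_mul_left _ (r_mul_right _ hj))
    | mul x y hx hy =>
      have : o (x * y) - o (φ (x * y)) = (o x - o (φ x)) * o y + o (φ x) * (o y - o (φ y)) := by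
        rw [map_mul, o_mul, o_mul]; noncomm_ring
      rw [this]
      exact add_mem (r_mul_right _ hx) (r_mul_left _ hy)
  · have : x + y - gaMap φ (x + y) = (x - gaMap φ x) + (y - gaMap φ y) := by rw [map_add]; abel
    rw [this]; exact add_mem hx hy
  · rw [map_smul, ← smul_sub]; exact Submodule.smul_mem _ _ hx

noncomputable def pg (m : ℕ) : FG (m + 1) →* FG m := FreeGroup.lift (xF m)
noncomputable def sg (m : ℕ) : FG m →* FG (m + 1) :=
  FreeGroup.lift fun j => FreeGroup.of j.castSucc
noncomputable def pi' (m : ℕ) : GA (m + 1) →ₐ[ℤ] GA m := gaMap (pg m)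

theorem pg_of {m : ℕ} (j : Fin (m + 1)) : pg m (FreeGroup.of j) = xF m j := by simp [pg]

theorem pg_castSucc {m : ℕ} (j : Fin (m + 1)) : pg m (xF (m + 1) j.castSucc) = xF m j := by
  rw [xF_castSucc, pg_of]

theorem pg_last {m : ℕ} : pg m (xF (m + 1) (Fin.last (m + 1))) = 1 := by
  rw [xF_last, map_inv, inv_eq_one, map_list_prod, List.map_ofFn]
  have e : (pg m ∘ fun j => FreeGroup.of j) = xF m := by
    funext j; exact pg_of j
  exact (congrArg (fun u => (List.ofFn u).prod) e).trans (xF_prod m)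

theorem pg_T {m : ℕ} (l : Fin (m + 1)) : pg m (T l.castSucc) = T l := by
  induction l using Fin.induction with
  | zero => simp [T_zero]
  | succ j ih =>
    rw [← Fin.succ_castSucc, T_succ, T_succ, map_mul, ih, map_inv, pg_of, xF_castSucc]

theorem pi_X {m : ℕ} (j : Fin (m + 1)) : pi' m (X j.castSucc) = X j := by
  rw [X, map_sub, map_one, pi', gaMap_o, pg_castSucc]

theorem pi_X_last {m : ℕ} : pi' m (X (Fin.last (m + 1))) = 0 := by
  rw [X, map_sub, map_one, pi', gaMap_o, pg_last, o_one, sub_self]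

theorem sg_last {m : ℕ} : FreeGroup.of (Fin.last m) * xF (m + 1) (Fin.last (m + 1))
    = sg m (xF m (Fin.last m)) := by
  rw [xF_last, xF_last, map_inv, map_list_prod, List.map_ofFn, List.ofFn_succ',
    List.concat_eq_append, List.prod_append]
  have e : (sg m ∘ fun j => FreeGroup.of j) = fun j : Fin m => FreeGroup.of j.castSucc := by
    funext j; simp [sg]
  rw [e]
  simp

theorem pi_surj (m : ℕ) : Function.Surjective (pi' m) := by
  have h : (pg m).comp (sg m) = MonoidHom.id _ := by
    apply FreeGroup.ext_hom
    intro j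
    simp [sg, pg_of, xF_castSucc]
  intro t
  refine span_o (P := fun t => ∃ u, pi' m u = t) t (fun g => ?_) ?_ ?_
  · exact ⟨o (sg m g), by rw [pi', gaMap_o]; congr 1; exact DFunLike.congr_fun h g⟩
  · rintro x y ⟨u, rfl⟩ ⟨v, rfl⟩; exact ⟨u + v, map_add _ _ _⟩
  · rintro c x ⟨u, rfl⟩; exact ⟨c • u, map_smul _ _ _⟩

theorem pi_ker {m : ℕ} {t : GA (m + 1)} (ht : pi' m t = 0) :
    t ∈ rIdeal (m + 1) (Fin.last (m + 1)) := by
  have h := sub_gaMap_mem (i := Fin.last (m + 1)) ((sg m).comp (pg m)) (fun j => by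
    refine Fin.lastCases ?_ (fun j => ?_) j
    · rw [MonoidHom.comp_apply, pg_of, ← sg_last, o_mul]
      have := X_mem (Fin.last (m + 1)) (- o (FreeGroup.of (Fin.last m))) 1
      have e : - o (FreeGroup.of (Fin.last m)) * X (Fin.last (m + 1)) * 1
        = o (FreeGroup.of (Fin.last m)) - o (FreeGroup.of (Fin.last m))
          * o (xF (m + 1) (Fin.last (m + 1))) := by rw [X]; noncomm_ring
      rwa [e] at this
    · rw [MonoidHom.comp_apply, pg_of, xF_castSucc]
      simp [sg]) t
  have e : gaMap ((sg m).comp (pg m)) t = gaMap (sg m) (pi' m t) := by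
    refine span_o (P := fun t => gaMap ((sg m).comp (pg m)) t = gaMap (sg m) (pi' m t)) t
      (fun g => ?_) (fun x y hx hy => ?_) (fun c x hx => ?_)
    · simp only [pi', gaMap_o, MonoidHom.comp_apply]
    · simp only [map_add, hx, hy]
    · simp only [map_smul, hx]
  rwa [e, ht, map_zero, sub_zero] at h

def Cyc {n : ℕ} (z : GA n) : Prop := ∀ i, z ∈ rIdeal n i

noncomputable def A {n : ℕ} (l : Fin n) (z : GA n) : GA n := o (T l.succ)⁻¹ * d l z

theorem sum_VA {n : ℕ} {z : GA n} (hz : Cyc z) : z = ∑ l, V l * A l z := by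
  have h := fox z
  rw [eps_r (hz 0), zero_add] at h
  refine h.trans (Finset.sum_congr rfl fun l _ => ?_)
  rw [V_eq, A, mul_assoc, ← mul_assoc (o _), ← o_mul, mul_inv_cancel, o_one, one_mul, X,
    xF_castSucc]

theorem A_r {n : ℕ} {z : GA n} (hz : Cyc z) {i l : Fin n} (h : l ≠ i) :
    A l z ∈ rIdeal n i.castSucc := r_mul_left _ (d_r h (hz _))

theorem pi_A {m : ℕ} {z : GA (m + 1)} (hz : Cyc z) (l : Fin (m + 1)) :
    pi' m (A l z) = pi' m (d (Fin.last m) z) := by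
  refine Fin.lastCases ?_ (fun l => ?_) l
  · rw [A, map_mul, pi', gaMap_o, map_inv, Fin.succ_last, T_last, pg_last, inv_one, o_one, one_mul]
  · have h0 : pi' m z = 0 := r_ker (pi' m).toRingHom pi_X_last (hz _)
    have h := chain (pi' m) (xF m) (fun j => by rw [pi', gaMap_o, pg_of]) l z (eps_r (hz 0))
    rw [h0, map_zero, Fin.sum_univ_castSucc] at h
    simp only [xF_castSucc, d_of, ite_mul, one_mul, zero_mul] at h
    rw [Finset.sum_ite_eq' Finset.univ l, if_pos (Finset.mem_univ _), ← T_last, d_T,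
      if_pos (Fin.castSucc_lt_last l), neg_mul, ← sub_eq_add_neg] at h
    have h := sub_eq_zero.1 h.symm
    rw [A, map_mul, h, pi', gaMap_o, map_inv, Fin.succ_castSucc, pg_T, ← mul_assoc, ← o_mul,
      inv_mul_cancel, o_one, one_mul]

theorem p_cyc {m : ℕ} (hm : 1 ≤ m) {z : GA (m + 1)} (hz : Cyc z) :
    Cyc (pi' m (d (Fin.last m) z)) := by
  intro i
  have : Nontrivial (Fin (m + 1)) := Fin.nontrivial_iff_two_le.2 (by omega)
  obtain ⟨l, hl⟩ := exists_ne i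
  rw [← pi_A hz l]
  exact r_map _ (pi_X i) (A_r hz hl)

theorem SymL_le_r {n : ℕ} {S : List (Fin (n + 1))} {i : Fin (n + 1)} (hi : i ∈ S) :
    SymL n S ≤ rIdeal n i := by
  refine iSup_le fun L => ?_
  obtain ⟨L, hL⟩ := L
  have hi : i ∈ L := hL.symm.subset hi
  change PL n L ≤ _
  clear hL
  induction L with
  | nil => simp at hi
  | cons j L ih =>
    have e1 : PL n (j :: L) = rIdeal n j * PL n L := by simp [PL]
    rw [e1, Submodule.mul_le]
    intro u hu v hv
    rcases List.mem_cons.1 hi with rfl | h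
    · exact r_mul_right _ hu
    · exact r_mul_left _ (ih h hv)

theorem step {m : ℕ} {z : GA (m + 1)} (hz : Cyc z)
    (hp : pi' m (d (Fin.last m) z) ∈ SymL m (List.finRange (m + 1))) :
    z ∈ SymL (m + 1) (List.finRange (m + 2)) := by
  obtain ⟨C, hC, hCp⟩ := SymL_surj (pi' m) (pi_surj m) Fin.castSucc pi_X _ hp
  have hCp : pi' m C = pi' m (d (Fin.last m) z) := hCp
  have hz' : z = ∑ l, V l * (A l z - C) - X (Fin.last (m + 1)) * C := by
    simp only [mul_sub, Finset.sum_sub_distrib, ← Finset.sum_mul, V_sum]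
    rw [← sum_VA hz]
    noncomm_ring
  rw [hz']
  refine sub_mem (Submodule.sum_mem _ fun l _ => ?_) ?_
  · have h1 : A l z - C ∈ SymL (m + 1) ((List.finRange (m + 2)).erase l.castSucc) := by
      refine inter_le l.castSucc _ ((List.nodup_finRange _).erase _)
        (fun h => (List.nodup_finRange _).not_mem_erase h) ?_ _ ?_
      · intro h
        have := congrArg List.length h
        rw [List.length_erase_of_mem (List.mem_finRange _)] at this
        simp at this
      · intro i hi
        have hi : i ≠ l.castSucc := by
          rintro rfl; exact (List.nodup_finRange _).not_mem_erase hi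
        revert hi
        refine Fin.lastCases ?_ (fun i => ?_) i
        · intro _
          apply pi_ker
          rw [map_sub, pi_A hz, hCp, sub_self]
        · intro hi
          refine sub_mem (A_r hz ?_) (SymL_le_r ?_ hC)
          · rintro rfl; exact hi rfl
          · exact List.mem_map.2 ⟨i, List.mem_finRange _, rfl⟩
    have h2 := r_mul_SymL _ _ (Submodule.mul_mem_mul (V_mem l) h1)
    rwa [SymL_congr (List.perm_cons_erase (List.mem_finRange _)).symm] at h2
  · have h1 : X (Fin.last (m + 1)) ∈ rIdeal (m + 1) (Fin.last (m + 1)) := by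
      simpa using X_mem (Fin.last (m + 1)) 1 1
    have h2 := r_mul_SymL _ _ (Submodule.mul_mem_mul h1 hC)
    rwa [SymL_congr (T := List.finRange (m + 2))] at h2
    rw [List.finRange_succ_last (n := m + 1), ← List.singleton_append]
    exact List.perm_append_comm

end SymP

namespace SymP

def Zf {B : Type*} [Ring B] : (n : ℕ) → (Fin n → B) → B
  | 0, _ => 1
  | n + 1, v => ∑ i : Fin (n + 1), (-1 : ℤ) ^ (i : ℕ) • (v i * Zf n (i.removeNth v))

theorem Zf_zero {B : Type*} [Ring B] (v : Fin 0 → B) : Zf 0 v = 1 := rfl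
theorem Zf_succ {B : Type*} [Ring B] {n : ℕ} (v : Fin (n + 1) → B) :
    Zf (n + 1) v = ∑ i : Fin (n + 1), (-1 : ℤ) ^ (i : ℕ) • (v i * Zf n (i.removeNth v)) := rfl

theorem Zf_map {B C : Type*} [Ring B] [Ring C] (φ : B →+* C) :
    ∀ (n : ℕ) (v : Fin n → B), φ (Zf n v) = Zf n (fun i => φ (v i)) := by
  intro n
  induction n with
  | zero => intro v; simp [Zf_zero]
  | succ n ih =>
    intro v
    simp only [Zf_succ, map_sum, map_zsmul, map_mul, ih]
    rfl

theorem Zf_alt {B : Type*} [Ring B] : ∀ n : ℕ,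
    ∃ f : AlternatingMap ℤ B B (Fin n), ∀ v, f v = Zf n v := by
  intro n
  induction n with
  | zero => exact ⟨AlternatingMap.constOfIsEmpty ℤ B (Fin 0) 1, fun v => rfl⟩
  | succ n ih =>
    obtain ⟨f, hf⟩ := ih
    let F : B →ₗ[ℤ] AlternatingMap ℤ B B (Fin n) :=
      (AddMonoidHom.mk' (fun x => (AddMonoidHom.mulLeft x).toIntLinearMap.compAlternatingMap f)
        (fun x y => by ext v; simp [add_mul])).toIntLinearMap
    refine ⟨AlternatingMap.alternatizeUncurryFin F, fun v => ?_⟩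
    rw [AlternatingMap.alternatizeUncurryFin_apply, Zf_succ]
    refine Finset.sum_congr rfl fun i _ => ?_
    rw [← hf]
    rfl

theorem Zf_eq_zero {B : Type*} [Ring B] {n : ℕ} (v : Fin n → B) (j : Fin n) (h : v j = 0) :
    Zf n v = 0 := by
  obtain ⟨f, hf⟩ := Zf_alt (B := B) n
  rw [← hf]; exact f.map_coord_zero j h

theorem Zf_eq_zero' {B : Type*} [Ring B] {n : ℕ} (v : Fin n → B) {i j : Fin n} (h : v i = v j)
    (hij : i ≠ j) : Zf n v = 0 := by
  obtain ⟨f, hf⟩ := Zf_alt (B := B) n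
  rw [← hf]; exact f.map_eq_zero_of_eq v h hij

noncomputable def w {n : ℕ} (j : Fin n) : GA n := o (T j.succ) - 1

noncomputable def z0 (n : ℕ) : GA n := Zf n w

theorem z0_cyc {n : ℕ} : Cyc (z0 (n + 1)) := by
  intro i
  obtain ⟨k, hk⟩ := exists_ne i
  obtain ⟨e, -, e2, e3⟩ := exists_e k i hk
  suffices h : e (z0 (n + 1)) = 0 by
    have := e3 (z0 (n + 1))
    rwa [h, sub_zero] at this
  have h1 : e (z0 (n + 1)) = Zf (n + 1) (fun j => e (w j)) := Zf_map e.toRingHom _ _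
  rw [h1]
  clear h1 hk
  revert e2 e3
  refine Fin.lastCases ?_ (fun i => ?_) i
  · intro e2 _
    refine Zf_eq_zero _ (Fin.last n) ?_
    rw [w, map_sub, map_one, Fin.succ_last, T_last, e2, sub_self]
  · intro e2 _
    have h2 : e (o (T i.succ)) = e (o (T i.castSucc)) := by
      have : o (T i.castSucc) = o (xF (n + 1) i.castSucc) * o (T i.succ) := by
        rw [xF_castSucc, ← o_mul, T_succ, mul_inv_cancel_left]
      rw [this, map_mul, e2, one_mul]
    revert h2
    refine Fin.cases ?_ (fun j => ?_) i
    · intro h2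
      refine Zf_eq_zero _ 0 ?_
      rw [w, map_sub, h2, Fin.castSucc_zero, T_zero, o_one, sub_self]
    · intro h2
      refine Zf_eq_zero' _ (i := j.castSucc) (j := j.succ) ?_ Fin.castSucc_lt_succ.ne
      rw [w, w, map_sub, map_sub, h2, Fin.succ_castSucc]

theorem pi_d_z0 (m : ℕ) :
    pi' m (d (Fin.last m) (z0 (m + 1))) = (-1 : ℤ) ^ (m + 1) • z0 m := by
  rw [z0, Zf_succ]
  simp only [map_sum, map_zsmul]
  rw [Finset.sum_eq_single (Fin.last m)]
  · rw [w, d_Xmul, d_T, if_pos Fin.castSucc_lt_succ, map_mul, map_neg, pi', gaMap_o, Fin.succ_last,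
      T_last, pg_last, o_one, pow_succ]
    have : gaMap (pg m) (Zf m ((Fin.last m).removeNth w)) = z0 m := by
      refine (Zf_map (gaMap (pg m)).toRingHom _ _).trans ?_
      rw [z0]
      congr 1
      funext j
      change gaMap (pg m) (w ((Fin.last m).succAbove j)) = _
      rw [Fin.succAbove_last, w, w, map_sub, map_one, gaMap_o, Fin.succ_castSucc, pg_T]
    rw [this]
    simp
  · intro i _ hi
    rw [w, d_Xmul, d_T, if_neg, zero_mul, map_zero, smul_zero]
    rw [not_lt, Fin.le_def]
    have : (i : ℕ) ≠ m := fun h => hi (Fin.ext h)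
    have := i.2
    simp
    omega
  · simp

theorem thmA : ∀ (m : ℕ) (z : GA m), (1 ≤ m → Cyc z) →
    ∃ c : ℤ, z - c • z0 m ∈ SymL m (List.finRange (m + 1)) := by
  intro m
  induction m with
  | zero =>
    intro z _
    have : ∃ c : ℤ, z = c • 1 := by
      refine span_o (P := fun z => ∃ c : ℤ, z = c • 1) z (fun g => ⟨1, ?_⟩) ?_ ?_
      · rw [Subsingleton.elim g 1, o_one, one_smul]
      · rintro x y ⟨c, rfl⟩ ⟨c', rfl⟩; exact ⟨c + c', (add_smul _ _ _).symm⟩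
      · rintro c x ⟨c', rfl⟩; exact ⟨c * c', smul_smul _ _ _⟩
    obtain ⟨c, rfl⟩ := this
    exact ⟨c, by simp [z0, Zf_zero]⟩
  | succ m ih =>
    intro z hz
    have hz := hz (by omega)
    obtain ⟨c, hc⟩ := ih (pi' m (d (Fin.last m) z)) (fun hm => p_cyc hm hz)
    refine ⟨c * (-1) ^ (m + 1), step (fun i => sub_mem (hz i) ?_) ?_⟩
    · exact zsmul_mem (z0_cyc i) _
    · rw [map_sub, map_sub, map_zsmul, map_zsmul, pi_d_z0, smul_smul, mul_assoc, ← mul_pow]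
      simpa using hc

end SymP

namespace SymP

open ExteriorAlgebra in
theorem Zf_iota {M : Type*} [AddCommGroup M] [Module ℚ M] : ∀ (n : ℕ) (v : Fin n → M),
    Zf n (fun i => ι ℚ (v i)) = n.factorial • ιMulti ℚ n v := by
  intro n
  induction n with
  | zero => intro v; simp [Zf_zero]
  | succ n ih =>
    intro v
    have h := congrArg (fun f => f v)
      (AlternatingMap.alternatizeUncurryFin_curryLeft (f := ιMulti ℚ (M := M) (n + 1)))
    simp only [AlternatingMap.alternatizeUncurryFin_apply, ιMulti_succ_curryLeft] at h
    have h2 : ∀ i : Fin (n + 1), Zf n (i.removeNth fun i => ι ℚ (v i))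
      = n.factorial • ιMulti ℚ n (i.removeNth v) := fun i => ih (i.removeNth v)
    rw [Zf_succ]
    simp only [h2]
    rw [Nat.factorial_succ, mul_comm, mul_smul]
    refine Eq.trans ?_ (congrArg (fun x => n.factorial • x) h)
    rw [Finset.smul_sum]
    refine Finset.sum_congr rfl fun i _ => ?_
    rw [mul_smul_comm, smul_comm]
    rfl

abbrev Mq (n : ℕ) := Fin n → ℚ
abbrev E (n : ℕ) := ExteriorAlgebra ℚ (Fin n → ℚ)

noncomputable abbrev io {n : ℕ} (v : Mq n) : E n := ExteriorAlgebra.ι ℚ v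

theorem io_sq {n : ℕ} (v : Mq n) : io v * io v = 0 := ExteriorAlgebra.ι_sq_zero v
theorem io_swap {n : ℕ} (v w : Mq n) : io v * io w = - (io w * io v) :=
  eq_neg_of_add_eq_zero_left (ExteriorAlgebra.ι_add_mul_swap v w)

noncomputable def Rr (n : ℕ) : Submodule ℚ (E n) := LinearMap.range (ExteriorAlgebra.ι ℚ)
noncomputable def K (n : ℕ) : Submodule ℚ (E n) := Rr n * ⊤

theorem io_mem {n : ℕ} (v : Mq n) : io v ∈ Rr n := ⟨v, rfl⟩
theorem io_K {n : ℕ} (v : Mq n) : io v ∈ K n := by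
  rw [← mul_one (io v)]
  exact Submodule.mul_mem_mul (io_mem v) trivial

theorem K_right {n : ℕ} {x : E n} (hx : x ∈ K n) (a : E n) : x * a ∈ K n := by
  refine Submodule.mul_induction_on hx (fun u hu v _ => ?_) (fun x y hx hy => ?_)
  · rw [mul_assoc]; exact Submodule.mul_mem_mul hu trivial
  · rw [add_mul]; exact add_mem hx hy

theorem K_left {n : ℕ} (a : E n) : ∀ {x : E n}, x ∈ K n → a * x ∈ K n := by
  induction a using ExteriorAlgebra.induction with
  | algebraMap r => intro x hx; rw [← Algebra.smul_def]; exact Submodule.smul_mem _ _ hx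
  | ι v => intro x hx; exact K_right (io_K v) x
  | mul a b ha hb => intro x hx; rw [mul_assoc]; exact ha (hb hx)
  | add a b ha hb => intro x hx; rw [add_mul]; exact add_mem (ha hx) (hb hx)

theorem top_K {n : ℕ} : ⊤ * K n ≤ K n := Submodule.mul_le.2 fun a _ _ hx => K_left a hx

theorem K_pow {n : ℕ} (k : ℕ) : K n ^ k ≤ Rr n ^ k * ⊤ := by
  induction k with
  | zero => rw [pow_zero, pow_zero, one_mul]; exact le_top
  | succ k ih =>
    rw [pow_succ, pow_succ]
    calc K n ^ k * K n ≤ Rr n ^ k * ⊤ * K n := mul_le_mul' ih le_rfl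
      _ = Rr n ^ k * (⊤ * K n) := mul_assoc _ _ _
      _ ≤ Rr n ^ k * (K n) := mul_le_mul' le_rfl top_K
      _ = _ := by rw [K, mul_assoc]

theorem Rr_pow (n : ℕ) : Rr n ^ (n + 1) = ⊥ := by
  have h : ExteriorAlgebra.ιMulti ℚ (M := Mq n) (n + 1) = 0 := by
    refine Module.Basis.ext_alternating (Pi.basisFun ℚ (Fin n)) fun v hv => ?_
    have := Fintype.card_le_of_injective v hv
    simp at this
  have h2 := ExteriorAlgebra.ιMulti_span_fixedDegree ℚ (M := Mq n) (n + 1)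
  rw [h] at h2
  change _ = Rr n ^ (n + 1) at h2
  rw [← h2, Submodule.span_eq_bot]
  rintro _ ⟨v, rfl⟩
  rfl

theorem K_nil (n : ℕ) : K n ^ (n + 1) = ⊥ := by
  have := K_pow (n := n) (n + 1)
  rw [Rr_pow, Submodule.bot_mul] at this
  exact le_bot_iff.1 this

/-- scaling by two -/
noncomputable def sc (n : ℕ) : E n →ₐ[ℚ] E n := ExteriorAlgebra.map ((2 : ℚ) • LinearMap.id)

theorem sc_io {n : ℕ} (v : Mq n) : sc n (io v) = 2 * io v := by
  rw [sc, ExteriorAlgebra.map_apply_ι]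
  simp [two_smul, two_mul]

def Q {n : ℕ} (x : E n) : Prop := ∃ (v : Mq n) (c : E n), x = (1 + io v) * c ∧
  (∀ a, a * c = c * a) ∧ sc n c = c ^ 4 ∧ c - 1 ∈ K n

theorem Q_io {n : ℕ} (v : Mq n) : Q (1 + io v) := ⟨v, 1, by simp, by simp, by simp, by simp⟩
theorem Q_one {n : ℕ} : Q (1 : E n) := by simpa using Q_io (0 : Mq n)

theorem vw_central {n : ℕ} (v w : Mq n) (a : E n) : a * (io v * io w) = io v * io w * a := by
  induction a using ExteriorAlgebra.induction with
  | algebraMap r => exact Algebra.commutes _ _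
  | ι u =>
    change io u * (io v * io w) = io v * io w * io u
    rw [← mul_assoc, io_swap u v, neg_mul, mul_assoc, io_swap u w, mul_neg, neg_neg, mul_assoc]
  | mul a b ha hb => rw [mul_assoc, hb, ← mul_assoc, ha, mul_assoc]
  | add a b ha hb => rw [add_mul, ha, hb, mul_add]

theorem Q_mul {n : ℕ} {x y : E n} (hx : Q x) (hy : Q y) : Q (x * y) := by
  obtain ⟨v, c, rfl, h1, h2, h3⟩ := hx
  obtain ⟨w, c', rfl, h1', h2', h3'⟩ := hy
  have hc := vw_central v w
  have hsq : (io v * io w) * (io v * io w) = 0 := by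
    rw [mul_assoc, hc (io w), mul_assoc (io v), io_sq, mul_zero, mul_zero]
  have hwv : io w * (io v * io w) = 0 := by rw [hc, mul_assoc, io_sq, mul_zero]
  have hvw : io v * (io v * io w) = 0 := by rw [← mul_assoc, io_sq, zero_mul]
  set q := io v * io w with hq
  refine ⟨v + w, (1 + q) * (c * c'), ?_, ?_, ?_, ?_⟩
  · have e : (1 + io v) * (1 + io w) = (1 + io (v + w)) * (1 + q) := by
      have : io (v + w) = io v + io w := map_add _ _ _
      rw [this]
      have e2 : (1 + (io v + io w)) * (1 + q) = 1 + io v + io w + q + io v * q + io w * q := by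
        noncomm_ring
      rw [e2, hvw, hwv, hq]; noncomm_ring
    calc (1 + io v) * c * ((1 + io w) * c') = (1 + io v) * (c * (1 + io w)) * c' := by
          noncomm_ring
      _ = (1 + io v) * (1 + io w) * (c * c') := by rw [← h1]; noncomm_ring
      _ = _ := by rw [e, mul_assoc]
  · intro a
    have hq1 : ∀ a, a * (1 + q) = (1 + q) * a := fun a => by
      rw [mul_add, add_mul, hc]; simp
    rw [← mul_assoc, hq1, mul_assoc, ← mul_assoc a, h1, mul_assoc c, h1']
    simp only [mul_assoc]
  · have e1 : sc n (1 + q) = (1 + q) ^ 4 := by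
      have h22 : sc n q = 4 * q := by
        rw [hq, map_mul, sc_io, sc_io]; noncomm_ring
      have e2 : (1 + q) ^ 2 = 1 + 2 * q := by
        rw [pow_two]
        have : (1 + q) * (1 + q) = 1 + 2 * q + q * q := by noncomm_ring
        rw [this, hsq, add_zero]
      have e3 : (1 + q) ^ 4 = 1 + 4 * q := by
        have : (1 + q) ^ 4 = (1 + q) ^ 2 * (1 + q) ^ 2 := by rw [← pow_add]
        rw [this, e2]
        have : (1 + 2 * q) * (1 + 2 * q) = 1 + 4 * q + 4 * (q * q) := by noncomm_ring
        rw [this, hsq, mul_zero, add_zero]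
      rw [e3, map_add, map_one, h22]
    have c1 : Commute c c' := (h1 c').symm
    have c2 : Commute (1 + q) (c * c') := by
      refine Commute.add_left (Commute.one_left _) ?_
      exact (hc _).symm
    rw [c2.mul_pow, c1.mul_pow, map_mul, map_mul, e1, h2, h2']
  · have e : (1 + q) * (c * c') - 1 = q * (c * c') + ((c - 1) * c' + (c' - 1)) := by noncomm_ring
    rw [e]
    exact add_mem (K_right (K_right (io_K v) _) _) (add_mem (K_right h3 _) h3')

theorem Q_K {n : ℕ} {x : E n} (hx : Q x) : x - 1 ∈ K n := by
  obtain ⟨v, c, rfl, h1, h2, h3⟩ := hx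
  have e : (1 + io v) * c - 1 = io v * c + (c - 1) := by noncomm_ring
  rw [e]
  exact add_mem (K_right (io_K v) _) h3

noncomputable def uu {n : ℕ} (v : Mq n) : (E n)ˣ where
  val := 1 + io v
  inv := 1 + io (-v)
  val_inv := by
    have : io (-v) = - io v := map_neg _ _
    rw [this]
    have : (1 + io v) * (1 + - io v) = 1 - io v * io v := by noncomm_ring
    rw [this, io_sq, sub_zero]
  inv_val := by
    have : io (-v) = - io v := map_neg _ _
    rw [this]
    have : (1 + -io v) * (1 + io v) = 1 - io v * io v := by noncomm_ring
    rw [this, io_sq, sub_zero]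

noncomputable def eb {n : ℕ} (j : Fin n) : Mq n := Pi.single j 1
noncomputable def vv {n : ℕ} : Fin (n + 1) → Mq n := Fin.cases 0 eb

noncomputable def rg (n : ℕ) : FG n →* (E n)ˣ :=
  FreeGroup.lift fun l => uu (vv l.castSucc) * (uu (vv l.succ))⁻¹

theorem rg_T {n : ℕ} (j : Fin (n + 1)) : rg n (T j) = uu (vv j) := by
  induction j using Fin.induction with
  | zero =>
    rw [T_zero, map_one]; ext; simp [uu, vv]
  | succ j ih => rw [T_succ, map_mul, ih, rg]; simp

theorem rg_Q {n : ℕ} (g : FG n) : Q (rg n g : E n) := by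
  have h1 : ∀ v : Mq n, Q ((uu v : (E n)ˣ) : E n) := fun v => Q_io v
  have h2 : ∀ v : Mq n, Q (((uu v)⁻¹ : (E n)ˣ) : E n) := fun v => Q_io (-v)
  induction g using FreeGroup.induction_on with
  | C1 => simpa using Q_one
  | of j => rw [rg, FreeGroup.lift_apply_of, Units.val_mul]; exact Q_mul (h1 _) (h2 _)
  | inv_of j _ =>
    rw [rg, map_inv, FreeGroup.lift_apply_of, mul_inv_rev, inv_inv, Units.val_mul]
    exact Q_mul (h1 _) (h2 _)
  | mul x y hx hy => rw [map_mul, Units.val_mul]; exact Q_mul hx hy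

noncomputable def rho (n : ℕ) : GA n →+* E n :=
  (MonoidAlgebra.lift ℤ (E n) (FG n) ((Units.coeHom _).comp (rg n))).toRingHom

theorem rho_o {n : ℕ} (g : FG n) : rho n (o g) = (rg n g : E n) := by
  change (MonoidAlgebra.lift ℤ (E n) (FG n) ((Units.coeHom _).comp (rg n))) (o g) = _
  simp [o]

theorem rho_r {n : ℕ} {i : Fin (n + 1)} {z : GA n} (hz : z ∈ rIdeal n i) : rho n z ∈ K n := by
  have := r_le (i := i)
    (AddSubgroup.toIntSubmodule ((K n).toAddSubgroup.comap (rho n).toAddMonoidHom)) (fun a b => by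
      change rho n _ ∈ K n
      rw [map_mul, map_mul, X, map_sub, map_one, rho_o]
      exact K_right (K_left _ (Q_K (rg_Q _))) _)
  exact this hz

theorem rho_PL {n : ℕ} (L : List (Fin (n + 1))) : ∀ z ∈ PL n L, rho n z ∈ K n ^ L.length := by
  induction L with
  | nil =>
    intro z hz
    simp only [PL, List.map_nil, List.prod_nil] at hz
    obtain ⟨c, rfl⟩ := Submodule.mem_one.1 hz
    simp only [List.length_nil, pow_zero]
    refine Submodule.mem_one.2 ⟨c, ?_⟩
    simp
  | cons j L ih =>
    intro z hz
    have e1 : PL n (j :: L) = rIdeal n j * PL n L := by simp [PL]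
    rw [e1] at hz
    rw [List.length_cons, pow_succ']
    refine Submodule.mul_induction_on hz (fun u hu v hv => ?_) (fun x y hx hy => ?_)
    · rw [map_mul]; exact Submodule.mul_mem_mul (rho_r hu) (ih v hv)
    · rw [map_add]; exact add_mem hx hy

theorem rho_SymL {n : ℕ} {z : GA n} (hz : z ∈ SymL n (List.finRange (n + 1))) : rho n z = 0 := by
  have : SymL n (List.finRange (n + 1)) ≤ LinearMap.ker (rho n).toAddMonoidHom.toIntLinearMap := by
    refine iSup_le fun L z hz => ?_
    have h := rho_PL L.1 z hz
    have hl : L.1.length = n + 1 := by simpa using L.2.length_eq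
    rw [hl, K_nil, Submodule.mem_bot] at h
    exact h
  exact this hz

theorem rho_z0 (n : ℕ) : rho n (z0 n) = n.factorial • ExteriorAlgebra.ιMulti ℚ n eb := by
  rw [z0, Zf_map, ← Zf_iota]
  congr 1
  funext j
  rw [w, map_sub, map_one, rho_o, rg_T]
  simp [uu, vv]

theorem final (n : ℕ) (hn : 3 ≤ n) (g : FG n) (hg : ∀ i : Fin (n + 1), g ∈ RSub n i) :
    o g - 1 ∈ SymL n (List.finRange (n + 1)) := by
  obtain ⟨c0, hc0⟩ := thmA n (o g - 1) (fun _ i => by simpa using r_mem (hg i) 1 1)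
  suffices hc : c0 = 0 by simpa [hc] using hc0
  set mu := ExteriorAlgebra.ιMulti ℚ n (eb (n := n)) with hmu
  let q : ℚ := c0 * n.factorial
  let τ : E n := q • mu
  have hτ : (rg n g : E n) = 1 + τ := by
    have h := rho_SymL hc0
    rw [map_sub, map_sub, map_one, rho_o, map_zsmul, rho_z0, sub_eq_zero, sub_eq_iff_eq_add'] at h
    rw [h]
    congr 1
    rw [← Nat.cast_smul_eq_nsmul ℚ, ← Int.cast_smul_eq_zsmul ℚ, smul_smul]
  have hKn : τ ∈ K n ^ n := by
    refine Submodule.smul_mem _ _ ?_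
    have h1 : mu ∈ Rr n ^ n := by
      have h2 := ExteriorAlgebra.ιMulti_span_fixedDegree ℚ (M := Mq n) n
      change _ = Rr n ^ n at h2
      rw [← h2]
      exact Submodule.subset_span ⟨_, rfl⟩
    refine pow_le_pow_left' (?_ : Rr n ≤ K n) n h1
    rintro _ ⟨v, rfl⟩
    exact io_K v
  have hKτ : ∀ x ∈ K n, x * τ = 0 := by
    intro x hx
    have := Submodule.mul_mem_mul hx hKn
    rw [← pow_succ', K_nil] at this
    exact this
  have hτK : τ ∈ K n := by
    have := Q_K (rg_Q g)
    rwa [hτ, add_sub_cancel_left] at this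
  have hττ := hKτ τ hτK
  have hsτ : sc n τ = (2 ^ n : ℚ) • τ := by
    rw [map_smul, sc, hmu, ExteriorAlgebra.map_apply_ιMulti, smul_comm]
    congr 1
    have : (((2 : ℚ) • LinearMap.id : Mq n →ₗ[ℚ] Mq n) ∘ eb) = fun i => (2 : ℚ) • eb i := rfl
    rw [this, AlternatingMap.map_smul_univ (c := fun _ => (2 : ℚ))]
    simp [hmu]
  obtain ⟨v, c, h0, h1, h2, h3⟩ := rg_Q g
  rw [hτ] at h0
  have hv := hKτ _ (io_K v)
  have e1 : 1 + (2 ^ n : ℚ) • τ = (1 + 2 * io v) * c ^ 4 := by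
    rw [← hsτ, ← map_one (sc n), ← map_add, h0, map_mul, h2, map_add, sc_io, map_one]
  have e4 : ∀ y : E n, y * y = 0 → (1 + y) ^ 4 = 1 + 4 * y := by
    intro q hsq
    have e2 : (1 + q) ^ 2 = 1 + 2 * q := by
      rw [pow_two]
      have : (1 + q) * (1 + q) = 1 + 2 * q + q * q := by noncomm_ring
      rw [this, hsq, add_zero]
    have : (1 + q) ^ 4 = (1 + q) ^ 2 * (1 + q) ^ 2 := by rw [← pow_add]
    rw [this, e2]
    have : (1 + 2 * q) * (1 + 2 * q) = 1 + 4 * q + 4 * (q * q) := by noncomm_ring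
    rw [this, hsq, mul_zero, add_zero]
  have e2 : 1 + 4 * τ = (1 + 4 * io v) * c ^ 4 := by
    have cc : Commute (1 + io v) c := h1 _
    rw [← e4 τ hττ, h0, cc.mul_pow, e4 _ (io_sq v)]
  have e3 : (1 + 2 * io v) * (1 + (2 ^ n : ℚ) • τ) = 1 + 4 * τ := by
    rw [e1, e2, ← mul_assoc]
    congr 1
    have : (1 + 2 * io v) * (1 + 2 * io v) = 1 + 4 * io v + 4 * (io v * io v) := by noncomm_ring
    rw [this, io_sq, mul_zero, add_zero]
  have e5 : (2 : ℚ) • io v + (2 ^ n : ℚ) • τ = (4 : ℚ) • τ := by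
    have t1 : (1 + 2 * io v) * (1 + (2 ^ n : ℚ) • τ)
      = 1 + (2 * io v + (2 ^ n : ℚ) • τ) + 2 * (io v * (2 ^ n : ℚ) • τ) := by
      generalize (2 ^ n : ℚ) • τ = y
      noncomm_ring
    rw [t1, mul_smul_comm, hv, smul_zero, mul_zero, add_zero, add_right_inj] at e3
    rw [Algebra.smul_def 2, Algebra.smul_def 4, map_ofNat, map_ofNat]
    exact e3
  let f : ∀ i, AlternatingMap ℚ (Mq n) ℚ (Fin i) := Pi.single n Matrix.detRowAlternating
  have e6 := congrArg (ExteriorAlgebra.liftAlternating (R := ℚ) f) e5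
  have f1 : f 1 = 0 := Pi.single_eq_of_ne (by omega) _
  have fn : f n = Matrix.detRowAlternating := Pi.single_eq_same _ _
  have fd : f n eb = 1 := by
    rw [fn]
    have : (eb : Fin n → Mq n) = (1 : Matrix (Fin n) (Fin n) ℚ) := by
      funext i; funext j
      simp [eb, Matrix.one_apply, Pi.single_apply, eq_comm]
    rw [this]; exact Matrix.det_one
  simp only [map_add, map_smul, ExteriorAlgebra.liftAlternating_ι, f1, τ, hmu,
    ExteriorAlgebra.liftAlternating_apply_ιMulti, fd, AlternatingMap.zero_apply, smul_zero,
    zero_add, smul_eq_mul, mul_one] at e6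
  have h8 : (8 : ℚ) ≤ 2 ^ n := by
    calc (8 : ℚ) = 2 ^ 3 := by norm_num
      _ ≤ 2 ^ n := pow_le_pow_right₀ (by norm_num) hn
  have hq : q = 0 := by
    have : (2 ^ n - 4) * q = 0 := by linarith
    rcases mul_eq_zero.1 this with h | h
    · linarith
    · exact h
  rcases mul_eq_zero.1 hq with h | h
  · exact_mod_cast h
  · exact absurd (by exact_mod_cast h) n.factorial_ne_zero

end SymP

/-- For `n ≥ 3`, every `g ∈ R_0 ∩ ⋯ ∩ R_n` satisfies `g - 1 ∈ (r_0, …, r_n)_Σ`. -/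
theorem intersection_sub_symmetric_product (n : ℕ) (hn : 3 ≤ n)
    (g : FreeGroup (Fin n)) (hg : ∀ i : Fin (n + 1), g ∈ RSub n i) :
    (MonoidAlgebra.of ℤ (FreeGroup (Fin n)) g : MonoidAlgebra ℤ (FreeGroup (Fin n))) - 1
      ∈ symProd n := by
  exact SymP.SymL_le_symProd n (SymP.final n hn g hg)
end

section
/- Let d ≥ 2 and set c_i := d^{d+1} − d^i for i = 0, 1, …, d. If natural numbers n_0, n_1, …, n_d satisfy n_0·c_0 + n_1·c_1 + ⋯ + n_d·c_d = c_0 + c_1 + ⋯ + c_d, then n_0 = n_1 = ⋯ = n_d = 1. -/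
theorem aux_coins (d : ℕ) (hd : 2 ≤ d) (L : ℕ) : ∀ (n : ℕ → ℕ) (k : ℕ),
    ∑ i ∈ Finset.range (L + 1), n i * d ^ i
      = k * d ^ (L + 1) + ∑ i ∈ Finset.range (L + 1), d ^ i →
    L + 1 + k * d ≤ ∑ i ∈ Finset.range (L + 1), n i ∧
    (∑ i ∈ Finset.range (L + 1), n i = L + 1 → ∀ i, i ≤ L → n i = 1) := by
  induction L with
  | zero =>
    intro n k h
    simp at h ⊢
    omega
  | succ L ih =>
    intro n k h
    have e1 : ∑ i ∈ Finset.range (L + 1 + 1), n i * d ^ i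
        = d * ∑ i ∈ Finset.range (L + 1), n (i + 1) * d ^ i + n 0 := by
      rw [Finset.sum_range_succ', Finset.mul_sum]
      simp only [pow_zero, mul_one]
      congr 1
      apply Finset.sum_congr rfl
      intro i _
      ring
    have e2 : ∑ i ∈ Finset.range (L + 1 + 1), d ^ i
        = d * ∑ i ∈ Finset.range (L + 1), d ^ i + 1 := by
      rw [Finset.sum_range_succ', Finset.mul_sum]
      simp only [pow_zero]
      congr 1
      apply Finset.sum_congr rfl
      intro i _
      ring
    have e3 : ∑ i ∈ Finset.range (L + 1 + 1), n i
        = ∑ i ∈ Finset.range (L + 1), n (i + 1) + n 0 := by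
      rw [Finset.sum_range_succ']
    rw [e1, e2] at h
    rw [e3]
    set A := ∑ i ∈ Finset.range (L + 1), n (i + 1) * d ^ i with hA
    set B := ∑ i ∈ Finset.range (L + 1), d ^ i with hB
    have h' : d * A + n 0 = d * (k * d ^ (L + 1) + B) + 1 := by
      rw [h]; ring
    obtain ⟨q, hq⟩ : ∃ q, n 0 = 1 + d * q := by
      have hm : n 0 % d = 1 := by
        have := congrArg (· % d) h'
        simp only [Nat.mul_add_mod] at this
        rw [this, Nat.mod_eq_of_lt (by omega)]
      exact ⟨n 0 / d, by have := Nat.mod_add_div (n 0) d; omega⟩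
    have h2 : A + q = k * d ^ (L + 1) + B := by
      have : d * (A + q) = d * (k * d ^ (L + 1) + B) := by
        rw [hq] at h'; linarith
      exact Nat.eq_of_mul_eq_mul_left (by omega) this
    obtain ⟨i1, i2⟩ := ih (fun i => n (i + 1) + if i = 0 then q else 0) k (by
      simp only [add_mul, Finset.sum_add_distrib, ite_mul, zero_mul]
      simpa using h2)
    have e4 : ∑ i ∈ Finset.range (L + 1), (n (i + 1) + if i = 0 then q else 0)
        = ∑ i ∈ Finset.range (L + 1), n (i + 1) + q := by
      simp [Finset.sum_add_distrib]
    rw [e4] at i1 i2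
    have hdq : 2 * q ≤ d * q := Nat.mul_le_mul_right q hd
    refine ⟨by omega, fun hN => ?_⟩
    have hq0 : q = 0 := by omega
    subst hq0
    have i3 := i2 (by omega)
    intro i hi
    cases i with
    | zero => simpa using hq
    | succ j => simpa using i3 j (by omega)

/-- Let `d ≥ 2` and `c_i = d^{d+1} - d^i` for `i = 0, …, d`.  If natural numbers
`n_0, …, n_d` satisfy `n_0·c_0 + ⋯ + n_d·c_d = c_0 + ⋯ + c_d`, then all `n_i = 1`. -/
theorem weights_lemma (d : ℕ) (hd : 2 ≤ d) (c : ℕ → ℕ)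
    (hc : ∀ i, i ≤ d → c i = d ^ (d + 1) - d ^ i) (n : ℕ → ℕ)
    (h : ∑ i ∈ Finset.range (d + 1), n i * c i = ∑ i ∈ Finset.range (d + 1), c i) :
    ∀ i, i ≤ d → n i = 1 := by
  have hc' : ∀ i ∈ Finset.range (d + 1), c i + d ^ i = d ^ (d + 1) := by
    intro i hi
    have hi' : i ≤ d := by simpa [Nat.lt_succ_iff] using hi
    rw [hc i hi']
    exact Nat.sub_add_cancel (Nat.pow_le_pow_right (by omega) (by omega))
  have e1 : ∑ i ∈ Finset.range (d + 1), n i * c i + ∑ i ∈ Finset.range (d + 1), n i * d ^ i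
      = (∑ i ∈ Finset.range (d + 1), n i) * d ^ (d + 1) := by
    rw [← Finset.sum_add_distrib, Finset.sum_mul]
    apply Finset.sum_congr rfl
    intro i hi
    rw [← mul_add, hc' i hi]
  have e2 : ∑ i ∈ Finset.range (d + 1), c i + ∑ i ∈ Finset.range (d + 1), d ^ i
      = (d + 1) * d ^ (d + 1) := by
    rw [← Finset.sum_add_distrib, Finset.sum_congr rfl hc']
    simp
  have hS : ∑ i ∈ Finset.range (d + 1), d ^ i < d ^ (d + 1) :=
    Nat.geomSum_lt hd (by simp)
  have key := aux_coins d hd d n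
  set N := ∑ i ∈ Finset.range (d + 1), n i
  set S := ∑ i ∈ Finset.range (d + 1), d ^ i
  set T := ∑ i ∈ Finset.range (d + 1), n i * d ^ i
  have hN : d + 1 ≤ N := by
    by_contra hlt
    have : (N + 1) * d ^ (d + 1) ≤ (d + 1) * d ^ (d + 1) :=
      Nat.mul_le_mul_right _ (by omega)
    rw [add_mul N] at this
    omega
  obtain ⟨k, hk⟩ := Nat.exists_eq_add_of_le hN
  obtain ⟨k1, k2⟩ := key k (by
    rw [hk, add_mul (d + 1)] at e1
    omega)
  have : k * 2 ≤ k * d := Nat.mul_le_mul_left k hd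
  exact k2 (by omega)
end

section
/- Let L be the free Lie algebra over ℤ on x_0, x_1, x_2, set x_3 := −x_0 − x_1 − x_2, and for i = 0, 1, 2, 3 let I_i be the Lie ideal of L generated by x_i. Then 2·⁅⁅x_0, x_2⁆, ⁅x_1, x_2⁆⁆ belongs to the symmetric commutator [I_0, I_1, I_2, I_3]_Σ := Σ_{ρ ∈ Sym({0,1,2,3})} [I_{ρ(0)}, I_{ρ(1)}, I_{ρ(2)}, I_{ρ(3)}], where iterated brackets of ideals are left-normed. -/
/-- The elements `x_0, x_1, x_2, x_3 = -x_0 - x_1 - x_2` of the free Lie `ℤ`-algebra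
on three generators. -/
noncomputable def xE (i : Fin 4) : FreeLieAlgebra ℤ (Fin 3) :=
  if h : (i : ℕ) < 3 then FreeLieAlgebra.of ℤ ⟨i, h⟩
  else -FreeLieAlgebra.of ℤ 0 - FreeLieAlgebra.of ℤ 1 - FreeLieAlgebra.of ℤ 2

/-- `I_i`, the Lie ideal of `L` generated by `x_i`. -/
noncomputable def IE (i : Fin 4) : LieIdeal ℤ (FreeLieAlgebra ℤ (Fin 3)) :=
  LieSubmodule.lieSpan ℤ (FreeLieAlgebra ℤ (Fin 3)) {xE i}

/-- Left-normed iterated bracket of a list of Lie ideals. -/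
def leftBracketIdeal {R L : Type*} [CommRing R] [LieRing L] [LieAlgebra R L] :
    List (LieIdeal R L) → LieIdeal R L
  | [] => ⊥
  | a :: l => l.foldl (fun x y => ⁅x, y⁆) a

/-- The symmetric commutator `[I_0, I_1, I_2, I_3]_Σ = Σ_ρ [I_{ρ(0)}, I_{ρ(1)}, I_{ρ(2)}, I_{ρ(3)}]`. -/
noncomputable def symCommE : LieIdeal ℤ (FreeLieAlgebra ℤ (Fin 3)) :=
  ⨆ ρ : Equiv.Perm (Fin 4),
    leftBracketIdeal (List.ofFn fun k : Fin 4 => IE (ρ k))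

theorem aux_gen (p q r s : Fin 4) (h : Function.Injective ![p, q, r, s]) :
    ⁅⁅⁅xE p, xE q⁆, xE r⁆, xE s⁆ ∈ symCommE := by
  have hb : Function.Bijective ![p, q, r, s] := Finite.injective_iff_bijective.mp h
  refine (le_iSup (fun ρ : Equiv.Perm (Fin 4) =>
    leftBracketIdeal (List.ofFn fun k : Fin 4 => IE (ρ k))) (Equiv.ofBijective _ hb)) ?_
  have hx : ∀ i, xE i ∈ IE i := fun i => LieSubmodule.subset_lieSpan rfl
  have : leftBracketIdeal (List.ofFn fun k : Fin 4 => IE ((Equiv.ofBijective _ hb) k))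
      = ⁅⁅⁅IE p, IE q⁆, IE r⁆, IE s⁆ := by
    simp [leftBracketIdeal, List.ofFn_succ]
  rw [this]
  exact LieSubmodule.lie_mem_lie (LieSubmodule.lie_mem_lie
    (LieSubmodule.lie_mem_lie (hx p) (hx q)) (hx r)) (hx s)

theorem aux_dbl (p q r s : Fin 4) (h : Function.Injective ![p, q, r, s])
    (h' : Function.Injective ![p, q, s, r]) :
    ⁅⁅xE p, xE q⁆, ⁅xE r, xE s⁆⁆ ∈ symCommE := by
  have e : ⁅⁅xE p, xE q⁆, ⁅xE r, xE s⁆⁆ =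
      ⁅⁅⁅xE p, xE q⁆, xE r⁆, xE s⁆ - ⁅⁅⁅xE p, xE q⁆, xE s⁆, xE r⁆ := by
    rw [leibniz_lie ⁅xE p, xE q⁆ (xE r) (xE s), ← lie_skew (xE r) ⁅⁅xE p, xE q⁆, xE s⁆,
      sub_eq_add_neg]
  rw [e]
  exact sub_mem (aux_gen p q r s h) (aux_gen p q s r h')

theorem aux_id {L : Type*} [LieRing L] (a b c : L) :
    (2 : ℤ) • ⁅⁅a, c⁆, ⁅b, c⁆⁆ = ⁅⁅c, a⁆, ⁅b, -a - b - c⁆⁆ + ⁅⁅b, c⁆, ⁅a, -a - b - c⁆⁆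
      - ⁅⁅a, b⁆, ⁅c, -a - b - c⁆⁆ := by
  rw [← lie_skew c a, ← lie_skew a c]
  simp only [lie_sub, lie_neg, neg_lie, lie_self]
  rw [← lie_skew b a, ← lie_skew c b, ← lie_skew c a]
  simp only [lie_neg, neg_lie]
  rw [← lie_skew ⁅b, c⁆ ⁅a, b⁆, ← lie_skew ⁅b, c⁆ ⁅a, c⁆, ← lie_skew ⁅a, c⁆ ⁅a, b⁆]
  simp only [two_smul, neg_neg, lie_zero]
  abel

/-- `2·⁅⁅x_0,x_2⁆,⁅x_1,x_2⁆⁆` belongs to the symmetric commutator `[I_0, I_1, I_2, I_3]_Σ`. -/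
theorem two_smul_serre_element_mem_symmetric_commutator :
    (2 : ℤ) • ⁅⁅xE 0, xE 2⁆, ⁅xE 1, xE 2⁆⁆ ∈ symCommE := by
  have h3 : xE 3 = -xE 0 - xE 1 - xE 2 := by
    simp [xE]
  rw [aux_id, ← h3]
  exact sub_mem (add_mem (aux_dbl 2 0 1 3 (by decide) (by decide))
    (aux_dbl 1 2 0 3 (by decide) (by decide))) (aux_dbl 0 1 2 3 (by decide) (by decide))
end

section
/- Let A be the Lie algebra over ℤ with generators e_0, e_1, e_2, z and relations 4·e_0 = ⁅z, e_1 + 2e_2⁆, 16·e_1 = ⁅z, −e_0 + 4e_2⁆, 64·e_2 = ⁅z, −2e_0 − 4e_1⁆ (i.e. A is the quotient of the free Lie ℤ-algebra on e_0, e_1, e_2, z by the Lie ideal generated by these three relation elements). Then the element α := 32·⁅e_0, e_1⁆ + 64·⁅e_0, e_2⁆ + 128·⁅e_1, e_2⁆ belongs to δ_4(A) but not to γ_4(A). -/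
/-- The augmentation ideal of the universal enveloping algebra `U(A)` of a Lie ring `A`:
the two-sided ideal generated by the image of `A`, viewed as a `ℤ`-submodule. -/
noncomputable def augIdealLie (A : Type*) [LieRing A] [LieAlgebra ℤ A] :
    Submodule ℤ (UniversalEnvelopingAlgebra ℤ A) :=
  Submodule.span ℤ
    {x | ∃ (l r : UniversalEnvelopingAlgebra ℤ A) (m : A),
      x = l * (UniversalEnvelopingAlgebra.ι ℤ m) * r}

/-- The `n`-th dimension subring `δ_n(A) = {a ∈ A : ι(a) ∈ ϖ^n}`. -/
noncomputable def dimensionSubring (A : Type*) [LieRing A] [LieAlgebra ℤ A] (n : ℕ) : Set A :=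
  {a : A | (UniversalEnvelopingAlgebra.ι ℤ a) ∈ (augIdealLie A) ^ n}

/-- `γ_n(A)`, the `n`-th term of the lower central series of Lie ideals, with `γ_1(A) = A`. -/
def gammaLie (A : Type*) [LieRing A] [LieAlgebra ℤ A] (n : ℕ) : LieSubmodule ℤ A A :=
  LieModule.lowerCentralSeries ℤ A A (n - 1)

/-- Generators `e_0, e_1, e_2` (indices `0,1,2`) and `z` (index `3`) of a free Lie
`ℤ`-algebra. -/
noncomputable def fgen (i : Fin 4) : FreeLieAlgebra ℤ (Fin 4) := FreeLieAlgebra.of ℤ i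

/-- The Lie ideal generated by the three relation elements
`4e_0 - ⁅z, e_1 + 2e_2⁆`, `16e_1 - ⁅z, -e_0 + 4e_2⁆`, `64e_2 - ⁅z, -2e_0 - 4e_1⁆`. -/
noncomputable def relIdeal : LieIdeal ℤ (FreeLieAlgebra ℤ (Fin 4)) :=
  LieSubmodule.lieSpan ℤ (FreeLieAlgebra ℤ (Fin 4))
    {(4 : ℤ) • fgen 0 - ⁅fgen 3, fgen 1 + (2 : ℤ) • fgen 2⁆,
     (16 : ℤ) • fgen 1 - ⁅fgen 3, -fgen 0 + (4 : ℤ) • fgen 2⁆,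
     (64 : ℤ) • fgen 2 - ⁅fgen 3, -((2 : ℤ) • fgen 0) - (4 : ℤ) • fgen 1⁆}

/-- The Lie algebra `A = ⟨e_0, e_1, e_2, z ∣ 4e_0 = ⁅z, e_1 + 2e_2⁆,
16e_1 = ⁅z, -e_0 + 4e_2⁆, 64e_2 = ⁅z, -2e_0 - 4e_1⁆⟩`. -/
abbrev RipsLie : Type := FreeLieAlgebra ℤ (Fin 4) ⧸ relIdeal

/-- The images `e_0, e_1, e_2, z` of the generators in `A`. -/
noncomputable def egen (i : Fin 4) : RipsLie :=
  LieSubmodule.Quotient.mk' relIdeal (fgen i)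


theorem ripsAux {U : Type*} [Ring U] (W : Submodule ℤ U) (a b c z : U)
    (ha : a ∈ W) (hb : b ∈ W) (hc : c ∈ W) (hz : z ∈ W)
    (h0 : (4 : ℤ) • a = z * (b + (2 : ℤ) • c) - (b + (2 : ℤ) • c) * z)
    (h1 : (16 : ℤ) • b = z * (-a + (4 : ℤ) • c) - (-a + (4 : ℤ) • c) * z)
    (h2 : (64 : ℤ) • c = z * (-((2 : ℤ) • a) - (4 : ℤ) • b) - (-((2 : ℤ) • a) - (4 : ℤ) • b) * z) :
    (32 : ℤ) • (a * b - b * a) + (64 : ℤ) • (a * c - c * a) + (128 : ℤ) • (b * c - c * b) ∈ W ^ 4 := by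
  obtain ⟨p, hp⟩ : ∃ p, p = z * a - a * z := ⟨_, rfl⟩
  obtain ⟨q, hq⟩ : ∃ q, q = z * b - b * z := ⟨_, rfl⟩
  obtain ⟨r, hr⟩ : ∃ r, r = z * c - c * z := ⟨_, rfl⟩
  have k0 : (4 : ℤ) • a = q + (2 : ℤ) • r := by
    rw [h0, hq, hr]; simp only [mul_add, add_mul, mul_smul_comm, smul_mul_assoc]; module
  have k1 : (16 : ℤ) • b = -p + (4 : ℤ) • r := by
    rw [h1, hp, hr]
    simp only [mul_add, add_mul, mul_smul_comm, smul_mul_assoc, mul_neg, neg_mul]; module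
  have k2 : (64 : ℤ) • c = -((2 : ℤ) • p) - (4 : ℤ) • q := by
    rw [h2, hp, hq]
    simp only [mul_sub, sub_mul, mul_smul_comm, smul_mul_assoc, mul_neg, neg_mul]; module
  have W4 : W ^ 4 = (W * W) * (W * W) := by rw [pow_succ, pow_succ, pow_succ, pow_one, mul_assoc]
  have W4' : W ^ 4 = W * (W * W) * W := by
    rw [pow_succ, pow_succ, pow_succ, pow_one, mul_assoc W W W]
  have pW : p ∈ W * W := hp ▸ sub_mem (Submodule.mul_mem_mul hz ha) (Submodule.mul_mem_mul ha hz)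
  have qW : q ∈ W * W := hq ▸ sub_mem (Submodule.mul_mem_mul hz hb) (Submodule.mul_mem_mul hb hz)
  have rW : r ∈ W * W := hr ▸ sub_mem (Submodule.mul_mem_mul hz hc) (Submodule.mul_mem_mul hc hz)
  have m22 : ∀ x y, x ∈ W * W → y ∈ W * W → x * y ∈ W ^ 4 := fun x y hx hy =>
    W4 ▸ Submodule.mul_mem_mul hx hy
  have m121 : ∀ x y z, x ∈ W → y ∈ W * W → z ∈ W → x * y * z ∈ W ^ 4 := fun x y z hx hy hz =>
    W4' ▸ Submodule.mul_mem_mul (Submodule.mul_mem_mul hx hy) hz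
  have a4 : (4 : ℤ) • a ∈ W * W := k0 ▸ add_mem qW (W * W |>.smul_mem _ rW)
  have b16 : (16 : ℤ) • b ∈ W * W := k1 ▸ add_mem (neg_mem pW) (W * W |>.smul_mem _ rW)
  -- products of a square with two generators
  have am : ∀ x y, x ∈ W → y ∈ W → (4 : ℤ) • (a * (x * y)) ∈ W ^ 4 := fun x y hx hy => by
    rw [← smul_mul_assoc]; exact m22 _ _ a4 (Submodule.mul_mem_mul hx hy)
  have ma : ∀ x y, x ∈ W → y ∈ W → (4 : ℤ) • (x * a * y) ∈ W ^ 4 := fun x y hx hy => by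
    rw [← smul_mul_assoc, ← mul_smul_comm]; exact m121 _ _ _ hx a4 hy
  have aa : ∀ x y, x ∈ W → y ∈ W → (4 : ℤ) • (x * y * a) ∈ W ^ 4 := fun x y hx hy => by
    rw [← mul_smul_comm]; exact m22 _ _ (Submodule.mul_mem_mul hx hy) a4
  have bm : ∀ x y, x ∈ W → y ∈ W → (16 : ℤ) • (b * (x * y)) ∈ W ^ 4 := fun x y hx hy => by
    rw [← smul_mul_assoc]; exact m22 _ _ b16 (Submodule.mul_mem_mul hx hy)
  have mb : ∀ x y, x ∈ W → y ∈ W → (16 : ℤ) • (x * b * y) ∈ W ^ 4 := fun x y hx hy => by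
    rw [← smul_mul_assoc, ← mul_smul_comm]; exact m121 _ _ _ hx b16 hy
  have bb : ∀ x y, x ∈ W → y ∈ W → (16 : ℤ) • (x * y * b) ∈ W ^ 4 := fun x y hx hy => by
    rw [← mul_smul_comm]; exact m22 _ _ (Submodule.mul_mem_mul hx hy) b16
  have L0 : ∀ x, (4 : ℤ) • (a * x) = q * x + (2 : ℤ) • (r * x) := fun x => by
    rw [← smul_mul_assoc, k0, add_mul, smul_mul_assoc]
  have R0 : ∀ x, (4 : ℤ) • (x * a) = x * q + (2 : ℤ) • (x * r) := fun x => by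
    rw [← mul_smul_comm, k0, mul_add, mul_smul_comm]
  have L1 : ∀ x, (16 : ℤ) • (b * x) = -(p * x) + (4 : ℤ) • (r * x) := fun x => by
    rw [← smul_mul_assoc, k1, add_mul, smul_mul_assoc, neg_mul]
  have R1 : ∀ x, (16 : ℤ) • (x * b) = -(x * p) + (4 : ℤ) • (x * r) := fun x => by
    rw [← mul_smul_comm, k1, mul_add, mul_smul_comm, mul_neg]
  have L2 : ∀ x, (64 : ℤ) • (c * x) = -((2 : ℤ) • (p * x)) - (4 : ℤ) • (q * x) := fun x => by
    rw [← smul_mul_assoc, k2, sub_mul, neg_mul, smul_mul_assoc, smul_mul_assoc]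
  have R2 : ∀ x, (64 : ℤ) • (x * c) = -((2 : ℤ) • (x * p)) - (4 : ℤ) • (x * q) := fun x => by
    rw [← mul_smul_comm, k2, mul_sub, mul_neg, mul_smul_comm, mul_smul_comm]
  have sm : ∀ (n : ℤ) {x : U}, x ∈ W ^ 4 → n • x ∈ W ^ 4 := fun n x hx => (W ^ 4).smul_mem n hx
  have M1 : (32 : ℤ) • (a * b) + (2 : ℤ) • (a * p) ∈ W ^ 4 := by
    have e : (32 : ℤ) • (a * b) + (2 : ℤ) • (a * p) = (2 : ℤ) • (q * r) + (4 : ℤ) • (r * r) := by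
      linear_combination (norm := module) (2 : ℤ) • R1 a + (2 : ℤ) • L0 r
    rw [e]; exact add_mem (sm _ (m22 _ _ qW rW)) (sm _ (m22 _ _ rW rW))
  have M1' : (32 : ℤ) • (b * a) + (2 : ℤ) • (p * a) ∈ W ^ 4 := by
    have e : (32 : ℤ) • (b * a) + (2 : ℤ) • (p * a) = (2 : ℤ) • (r * q) + (4 : ℤ) • (r * r) := by
      linear_combination (norm := module) (2 : ℤ) • L1 a + (2 : ℤ) • R0 r
    rw [e]; exact add_mem (sm _ (m22 _ _ rW qW)) (sm _ (m22 _ _ rW rW))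
  have M2 : (64 : ℤ) • (a * c) + (2 : ℤ) • (a * p) ∈ W ^ 4 := by
    have e : (64 : ℤ) • (a * c) + (2 : ℤ) • (a * p) = (-1 : ℤ) • (q * q) + (-2 : ℤ) • (r * q) := by
      linear_combination (norm := module) R2 a - L0 q
    rw [e]; exact add_mem (sm _ (m22 _ _ qW qW)) (sm _ (m22 _ _ rW qW))
  have M2' : (64 : ℤ) • (c * a) + (2 : ℤ) • (p * a) ∈ W ^ 4 := by
    have e : (64 : ℤ) • (c * a) + (2 : ℤ) • (p * a) = (-1 : ℤ) • (q * q) + (-2 : ℤ) • (q * r) := by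
      linear_combination (norm := module) L2 a - R0 q
    rw [e]; exact add_mem (sm _ (m22 _ _ qW qW)) (sm _ (m22 _ _ qW rW))
  have M3 : (4 : ℤ) • (a * p) ∈ W ^ 4 := by
    rw [← smul_mul_assoc]; exact m22 _ _ a4 pW
  have M4' : (32 : ℤ) • (b * a) - (8 : ℤ) • (b * q) ∈ W ^ 4 := by
    have e : (32 : ℤ) • (b * a) - (8 : ℤ) • (b * q) = (-1 : ℤ) • (p * r) + (4 : ℤ) • (r * r) := by
      linear_combination (norm := module) (8 : ℤ) • R0 b + L1 r
    rw [e]; exact add_mem (sm _ (m22 _ _ pW rW)) (sm _ (m22 _ _ rW rW))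
  have M5 : (64 : ℤ) • (a * c) - (32 : ℤ) • (r * c) ∈ W ^ 4 := by
    have e : (64 : ℤ) • (a * c) - (32 : ℤ) • (r * c) =
        (16 : ℤ) • (z * b * c) - (16 : ℤ) • (b * (z * c)) := by
      have : q * c = z * b * c - b * (z * c) := by rw [hq, sub_mul, mul_assoc b]
      linear_combination (norm := module) (16 : ℤ) • L0 c + (16 : ℤ) • this
    rw [e]; exact sub_mem (mb _ _ hz hc) (bm _ _ hz hc)
  have M5' : (64 : ℤ) • (c * a) - (32 : ℤ) • (c * r) ∈ W ^ 4 := by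
    have e : (64 : ℤ) • (c * a) - (32 : ℤ) • (c * r) =
        (16 : ℤ) • (c * z * b) - (16 : ℤ) • (c * b * z) := by
      have : c * q = c * z * b - c * b * z := by rw [hq, mul_sub, mul_assoc, mul_assoc]
      linear_combination (norm := module) (16 : ℤ) • R0 c + (16 : ℤ) • this
    rw [e]; exact sub_mem (bb _ _ hc hz) (mb _ _ hc hz)
  have M6 : (128 : ℤ) • (b * c) - (32 : ℤ) • (r * c) ∈ W ^ 4 := by
    have e : (128 : ℤ) • (b * c) - (32 : ℤ) • (r * c) =
        (-2 : ℤ) • (4 : ℤ) • (z * a * c) - (-2 : ℤ) • (4 : ℤ) • (a * (z * c)) := by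
      have : p * c = z * a * c - a * (z * c) := by rw [hp, sub_mul, mul_assoc a]
      linear_combination (norm := module) (8 : ℤ) • L1 c - (8 : ℤ) • this
    rw [e]; exact sub_mem (sm _ (ma _ _ hz hc)) (sm _ (am _ _ hz hc))
  have M6' : (128 : ℤ) • (c * b) - (32 : ℤ) • (c * r) ∈ W ^ 4 := by
    have e : (128 : ℤ) • (c * b) - (32 : ℤ) • (c * r) =
        (-2 : ℤ) • (4 : ℤ) • (c * z * a) - (-2 : ℤ) • (4 : ℤ) • (c * a * z) := by
      have : c * p = c * z * a - c * a * z := by rw [hp, mul_sub, mul_assoc, mul_assoc]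
      linear_combination (norm := module) (8 : ℤ) • R1 c - (8 : ℤ) • this
    rw [e]; exact sub_mem (sm _ (aa _ _ hc hz)) (sm _ (ma _ _ hc hz))
  have M7 : (128 : ℤ) • (b * c) + (8 : ℤ) • (b * q) ∈ W ^ 4 := by
    have e : (128 : ℤ) • (b * c) + (8 : ℤ) • (b * q) =
        (-1 : ℤ) • (4 : ℤ) • (b * z * a) - (-1 : ℤ) • (4 : ℤ) • (b * a * z) := by
      have : b * p = b * z * a - b * a * z := by rw [hp, mul_sub, mul_assoc, mul_assoc]
      linear_combination (norm := module) (2 : ℤ) • R2 b - (4 : ℤ) • this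
    rw [e]; exact sub_mem (sm _ (aa _ _ hb hz)) (sm _ (ma _ _ hb hz))
  -- 128bc ≡ -2ap
  have N1 : (128 : ℤ) • (b * c) + (2 : ℤ) • (a * p) ∈ W ^ 4 := by
    convert add_mem (sub_mem M6 M5) M2 using 1; module
  have N1' : (128 : ℤ) • (c * b) + (2 : ℤ) • (p * a) ∈ W ^ 4 := by
    convert add_mem (sub_mem M6' M5') M2' using 1; module
  -- 2ap + 2pa ≡ 0
  have N2 : (2 : ℤ) • (a * p) + (2 : ℤ) • (p * a) ∈ W ^ 4 := by
    convert add_mem (sub_mem N1 M7) (sub_mem M1' M4') using 1; module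
  convert add_mem (sub_mem (add_mem (add_mem M1 M2) N1) (add_mem (add_mem M1' M2') N1'))
    (add_mem (sm 3 N2) (sm (-3) M3)) using 1
  module

theorem ripsAux' {U : Type*} [Ring U] [inst : Algebra ℤ U] (W : Submodule ℤ U) (a b c z : U)
    (ha : a ∈ W) (hb : b ∈ W) (hc : c ∈ W) (hz : z ∈ W)
    (h0 : (4 : ℤ) • a = z * (b + (2 : ℤ) • c) - (b + (2 : ℤ) • c) * z)
    (h1 : (16 : ℤ) • b = z * (-a + (4 : ℤ) • c) - (-a + (4 : ℤ) • c) * z)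
    (h2 : (64 : ℤ) • c = z * (-((2 : ℤ) • a) - (4 : ℤ) • b) - (-((2 : ℤ) • a) - (4 : ℤ) • b) * z) :
    (32 : ℤ) • (a * b - b * a) + (64 : ℤ) • (a * c - c * a) + (128 : ℤ) • (b * c - c * b) ∈ W ^ 4 := by
  obtain rfl : inst = Ring.toIntAlgebra U := Subsingleton.elim _ _
  exact ripsAux W a b c z ha hb hc hz h0 h1 h2

/-- The quotient map as a Lie homomorphism. -/
noncomputable def ripsMk : FreeLieAlgebra ℤ (Fin 4) →ₗ⁅ℤ⁆ RipsLie :=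
  { (relIdeal.toSubmodule.mkQ) with
    map_lie' := fun {_ _} => rfl }

theorem ripsMk_fgen (i : Fin 4) : ripsMk (fgen i) = egen i := rfl

theorem ripsMk_surj : Function.Surjective ripsMk := Quot.mk_surjective

theorem ripsMk_zero {x : FreeLieAlgebra ℤ (Fin 4)} : ripsMk x = 0 ↔ x ∈ relIdeal :=
  Submodule.Quotient.mk_eq_zero relIdeal.toSubmodule

theorem rips_rel0 : (4 : ℤ) • egen 0 = ⁅egen 3, egen 1 + (2 : ℤ) • egen 2⁆ := by
  have h := (ripsMk_zero (x := (4 : ℤ) • fgen 0 - ⁅fgen 3, fgen 1 + (2 : ℤ) • fgen 2⁆)).2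
    (LieSubmodule.subset_lieSpan (by simp))
  simp only [map_sub, LieHom.map_lie, map_add, map_smul, ripsMk_fgen] at h
  exact sub_eq_zero.1 h

theorem rips_rel1 : (16 : ℤ) • egen 1 = ⁅egen 3, -egen 0 + (4 : ℤ) • egen 2⁆ := by
  have h := (ripsMk_zero (x := (16 : ℤ) • fgen 1 - ⁅fgen 3, -fgen 0 + (4 : ℤ) • fgen 2⁆)).2
    (LieSubmodule.subset_lieSpan (by simp))
  simp only [map_sub, LieHom.map_lie, map_add, map_smul, map_neg, ripsMk_fgen] at h
  exact sub_eq_zero.1 h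

theorem rips_rel2 : (64 : ℤ) • egen 2 = ⁅egen 3, -((2 : ℤ) • egen 0) - (4 : ℤ) • egen 1⁆ := by
  have h := (ripsMk_zero (x := (64 : ℤ) • fgen 2 -
      ⁅fgen 3, -((2 : ℤ) • fgen 0) - (4 : ℤ) • fgen 1⁆)).2
    (LieSubmodule.subset_lieSpan (by simp))
  simp only [map_sub, LieHom.map_lie, map_smul, map_neg, ripsMk_fgen] at h
  exact sub_eq_zero.1 h

theorem rips_mem_delta :
    ((32 : ℤ) • ⁅egen 0, egen 1⁆ + (64 : ℤ) • ⁅egen 0, egen 2⁆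
        + (128 : ℤ) • ⁅egen 1, egen 2⁆) ∈ dimensionSubring RipsLie 4 := by
  have hW : ∀ m : RipsLie, UniversalEnvelopingAlgebra.ι ℤ m ∈ augIdealLie RipsLie := fun m =>
    Submodule.subset_span ⟨1, 1, m, by simp⟩
  have H := ripsAux' (augIdealLie RipsLie) _ _ _ _ (hW (egen 0)) (hW (egen 1)) (hW (egen 2))
    (hW (egen 3))
  have hs : ∀ (n : ℤ) (x : RipsLie), UniversalEnvelopingAlgebra.ι ℤ (n • x) =
      n • UniversalEnvelopingAlgebra.ι ℤ x := fun n x => by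
    have h1 : UniversalEnvelopingAlgebra.ι ℤ (n • x) =
      n • UniversalEnvelopingAlgebra.ι ℤ x := map_zsmul _ n x
    exact h1
  have k0 := congrArg (UniversalEnvelopingAlgebra.ι ℤ) rips_rel0
  have k1 := congrArg (UniversalEnvelopingAlgebra.ι ℤ) rips_rel1
  have k2 := congrArg (UniversalEnvelopingAlgebra.ι ℤ) rips_rel2
  simp only [LieHom.map_lie, map_add, map_sub, map_neg, hs,
    LieRing.of_associative_ring_bracket] at k0 k1 k2
  have H' := H k0 k1 k2
  change UniversalEnvelopingAlgebra.ι ℤ _ ∈ augIdealLie RipsLie ^ 4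
  simp only [LieHom.map_lie, map_add, hs,
    LieRing.of_associative_ring_bracket]
  exact H'

/-- Class three nilpotent model; coordinates `e0 e1 e2 f0 f1 f2 z c`. -/
@[ext]
structure RM where
  a0 : ZMod 256
  a1 : ZMod 256
  a2 : ZMod 256
  b0 : ZMod 256
  b1 : ZMod 256
  b2 : ZMod 256
  z : ZMod 256
  c : ZMod 256

namespace RM

instance : Zero RM := ⟨⟨0, 0, 0, 0, 0, 0, 0, 0⟩⟩
instance : Add RM := ⟨fun x y => ⟨x.a0 + y.a0, x.a1 + y.a1, x.a2 + y.a2,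
  x.b0 + y.b0, x.b1 + y.b1, x.b2 + y.b2, x.z + y.z, x.c + y.c⟩⟩
instance : Neg RM := ⟨fun x => ⟨-x.a0, -x.a1, -x.a2, -x.b0, -x.b1, -x.b2, -x.z, -x.c⟩⟩
instance : Bracket RM RM := ⟨fun x y => ⟨0, 0, 0,
  x.z * y.a0 - y.z * x.a0, x.z * y.a1 - y.z * x.a1, x.z * y.a2 - y.z * x.a2, 0,
  4 * (x.a0 * y.a1 - x.a1 * y.a0) + 2 * (x.a0 * y.a2 - x.a2 * y.a0)
    + (x.a1 * y.a2 - x.a2 * y.a1) + 64 * (x.b0 * y.a0 - x.a0 * y.b0)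
    + 16 * (x.b1 * y.a1 - x.a1 * y.b1) + 4 * (x.b2 * y.a2 - x.a2 * y.b2)⟩⟩

theorem zero_def : (0 : RM) = ⟨0, 0, 0, 0, 0, 0, 0, 0⟩ := rfl
theorem add_def (x y : RM) : x + y = ⟨x.a0 + y.a0, x.a1 + y.a1, x.a2 + y.a2,
  x.b0 + y.b0, x.b1 + y.b1, x.b2 + y.b2, x.z + y.z, x.c + y.c⟩ := rfl
theorem neg_def (x : RM) :
  -x = ⟨-x.a0, -x.a1, -x.a2, -x.b0, -x.b1, -x.b2, -x.z, -x.c⟩ := rfl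
theorem lie_def (x y : RM) : ⁅x, y⁆ = ⟨0, 0, 0,
  x.z * y.a0 - y.z * x.a0, x.z * y.a1 - y.z * x.a1, x.z * y.a2 - y.z * x.a2, 0,
  4 * (x.a0 * y.a1 - x.a1 * y.a0) + 2 * (x.a0 * y.a2 - x.a2 * y.a0)
    + (x.a1 * y.a2 - x.a2 * y.a1) + 64 * (x.b0 * y.a0 - x.a0 * y.b0)
    + 16 * (x.b1 * y.a1 - x.a1 * y.b1) + 4 * (x.b2 * y.a2 - x.a2 * y.b2)⟩ := rfl

instance : AddCommGroup RM where
  add_assoc x y z := by simp only [add_def, add_assoc]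
  zero_add x := by simp only [add_def, zero_def, zero_add]
  add_zero x := by simp only [add_def, zero_def, add_zero]
  add_comm x y := by simp only [add_def, add_comm]
  neg_add_cancel x := by simp only [add_def, neg_def, zero_def, neg_add_cancel]
  nsmul := nsmulRec
  zsmul := zsmulRec

instance : LieRing RM where
  add_lie x y z := by ext <;> simp only [add_def, lie_def] <;> ring
  lie_add x y z := by ext <;> simp only [add_def, lie_def] <;> ring
  lie_self x := by ext <;> simp only [zero_def, lie_def] <;> ring
  leibniz_lie x y z := by ext <;> simp only [add_def, lie_def] <;> ring

theorem nsmul_def (n : ℕ) (x : RM) : n • x = ⟨n * x.a0, n * x.a1, n * x.a2,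
    n * x.b0, n * x.b1, n * x.b2, n * x.z, n * x.c⟩ := by
  induction n with
  | zero => rw [zero_nsmul]; ext <;> simp [zero_def]
  | succ n ih => rw [succ_nsmul, ih]; ext <;> simp only [add_def] <;> push_cast <;> ring

theorem smul_def (n : ℤ) (x : RM) : n • x = ⟨n * x.a0, n * x.a1, n * x.a2,
    n * x.b0, n * x.b1, n * x.b2, n * x.z, n * x.c⟩ := by
  obtain ⟨m, rfl | rfl⟩ := n.eq_nat_or_neg
  · rw [natCast_zsmul, nsmul_def]; simp
  · rw [neg_smul, natCast_zsmul, nsmul_def, neg_def]; simp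

theorem lie4 (x y z w : RM) : ⁅x, ⁅y, ⁅z, w⁆⁆⁆ = 0 := by
  ext <;> simp only [zero_def, lie_def] <;> ring

/-- Carrier condition of the ideal of relations. -/
def Cond (x : RM) : Prop :=
  x.z = 0 ∧ x.c = 0 ∧ -4 * x.a1 - 2 * x.a2 + 64 * x.b0 = 0 ∧ 4 * x.a0 - x.a2 + 16 * x.b1 = 0 ∧
    2 * x.a0 + x.a1 + 4 * x.b2 = 0 ∧ 64 * x.a0 = 0 ∧ 16 * x.a1 = 0 ∧ 4 * x.a2 = 0

theorem Cond.add {x y : RM} (hx : Cond x) (hy : Cond y) : Cond (x + y) := by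
  obtain ⟨h1, h2, h3, h4, h5, h6, h7, h8⟩ := hx
  obtain ⟨k1, k2, k3, k4, k5, k6, k7, k8⟩ := hy
  refine ⟨?_, ?_, ?_, ?_, ?_, ?_, ?_, ?_⟩ <;> simp only [add_def]
  · linear_combination h1 + k1
  · linear_combination h2 + k2
  · linear_combination h3 + k3
  · linear_combination h4 + k4
  · linear_combination h5 + k5
  · linear_combination h6 + k6
  · linear_combination h7 + k7
  · linear_combination h8 + k8

theorem Cond.smul (n : ℤ) {x : RM} (hx : Cond x) : Cond (n • x) := by
  obtain ⟨h1, h2, h3, h4, h5, h6, h7, h8⟩ := hx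
  refine ⟨?_, ?_, ?_, ?_, ?_, ?_, ?_, ?_⟩ <;> simp only [smul_def]
  · linear_combination n * h1
  · linear_combination n * h2
  · linear_combination n * h3
  · linear_combination n * h4
  · linear_combination n * h5
  · linear_combination n * h6
  · linear_combination n * h7
  · linear_combination n * h8

theorem Cond.lie (y : RM) {x : RM} (hx : Cond x) : Cond ⁅y, x⁆ := by
  obtain ⟨h1, h2, h3, h4, h5, h6, h7, h8⟩ := hx
  refine ⟨?_, ?_, ?_, ?_, ?_, ?_, ?_, ?_⟩ <;> simp only [lie_def]
  · linear_combination -y.a0 * h3 - y.a1 * h4 - y.a2 * h5 + y.b0 * h6 + y.b1 * h7 + y.b2 * h8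
  · linear_combination y.z * h6 - 64 * y.a0 * h1
  · linear_combination y.z * h7 - 16 * y.a1 * h1
  · linear_combination y.z * h8 - 4 * y.a2 * h1
  all_goals ring

theorem Cond.zero : Cond 0 := by
  simp [Cond, zero_def]

/-- The ideal of relations in the model. -/
def J : LieIdeal ℤ RM where
  carrier := {x | Cond x}
  add_mem' := Cond.add
  zero_mem' := Cond.zero
  smul_mem' n _ := Cond.smul n
  lie_mem := Cond.lie _

/-- The images of the generators. -/
def gen : Fin 4 → RM :=
  ![⟨1, 0, 0, 0, 0, 0, 0, 0⟩, ⟨0, 1, 0, 0, 0, 0, 0, 0⟩, ⟨0, 0, 1, 0, 0, 0, 0, 0⟩,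
    ⟨0, 0, 0, 0, 0, 0, 1, 0⟩]

/-- The map from the free Lie algebra to the model. -/
noncomputable def φ : FreeLieAlgebra ℤ (Fin 4) →ₗ⁅ℤ⁆ RM := FreeLieAlgebra.lift ℤ gen

theorem φ_fgen (i : Fin 4) : φ (fgen i) = gen i := FreeLieAlgebra.lift_of_apply _ _

theorem gen0 : gen 0 = ⟨1, 0, 0, 0, 0, 0, 0, 0⟩ := rfl
theorem gen1 : gen 1 = ⟨0, 1, 0, 0, 0, 0, 0, 0⟩ := rfl
theorem gen2 : gen 2 = ⟨0, 0, 1, 0, 0, 0, 0, 0⟩ := rfl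
theorem gen3 : gen 3 = ⟨0, 0, 0, 0, 0, 0, 1, 0⟩ := rfl

theorem relIdeal_le : relIdeal ≤ J.comap φ := by
  refine LieSubmodule.lieSpan_le.2 ?_
  rintro x (rfl | rfl | rfl)
  all_goals
    simp only [SetLike.mem_coe, LieIdeal.mem_comap, map_sub, LieHom.map_lie, map_add, map_smul,
      map_neg, φ_fgen]
    change Cond _
    simp only [Cond, gen0, gen1, gen2, gen3, sub_eq_add_neg, add_def, neg_def, smul_def, lie_def]
    decide

theorem lcs_bot : LieModule.lowerCentralSeries ℤ RM RM 3 = ⊥ := by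
  rw [eq_bot_iff]
  simp only [LieModule.lowerCentralSeries_succ, LieModule.lowerCentralSeries_zero]
  have h1 : ⁅(⊤ : LieIdeal ℤ RM), (⊤ : LieIdeal ℤ RM)⁆ ≤ ({
      carrier := {x | ∀ y z : RM, ⁅y, ⁅z, x⁆⁆ = 0}
      add_mem' := fun {a b} ha hb y z => by simp [ha y z, hb y z]
      zero_mem' := fun y z => by simp
      smul_mem' := fun n x hx y z => by simp [hx y z]
      lie_mem := fun {x m} hm y z => by rw [hm z x, lie_zero] } : LieIdeal ℤ RM) := by
    rw [LieSubmodule.lie_le_iff]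
    intro x _ w _ y z
    exact lie4 y z x w
  have h2 : ⁅(⊤ : LieIdeal ℤ RM), ⁅(⊤ : LieIdeal ℤ RM), (⊤ : LieIdeal ℤ RM)⁆⁆ ≤ ({
      carrier := {x | ∀ y : RM, ⁅y, x⁆ = 0}
      add_mem' := fun {a b} ha hb y => by simp [ha y, hb y]
      zero_mem' := fun y => by simp
      smul_mem' := fun n x hx y => by simp [hx y]
      lie_mem := fun {x m} hm y => by rw [hm x, lie_zero] } : LieIdeal ℤ RM) := by
    rw [LieSubmodule.lie_le_iff]
    intro x _ w hw y
    exact h1 hw y x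
  rw [LieSubmodule.lie_le_iff]
  intro x _ w hw
  exact (LieSubmodule.mem_bot _).2 (h2 hw x)

end RM

theorem rips_notMem_gamma :
    ((32 : ℤ) • ⁅egen 0, egen 1⁆ + (64 : ℤ) • ⁅egen 0, egen 2⁆
        + (128 : ℤ) • ⁅egen 1, egen 2⁆) ∉ gammaLie RipsLie 4 := by
  intro h
  change _ ∈ LieModule.lowerCentralSeries ℤ RipsLie RipsLie 3 at h
  rw [← LieIdeal.lowerCentralSeries_map_eq 3 ripsMk_surj] at h
  obtain ⟨⟨y, hy⟩, hyα⟩ := LieIdeal.mem_map_of_surjective ripsMk_surj h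
  have hφ : RM.φ y = 0 := by
    have := LieIdeal.map_lowerCentralSeries_le 3 (LieIdeal.mem_map (f := RM.φ) hy)
    rw [RM.lcs_bot] at this
    exact (LieSubmodule.mem_bot _).1 this
  have h0 : ripsMk (((32 : ℤ) • ⁅fgen 0, fgen 1⁆ + (64 : ℤ) • ⁅fgen 0, fgen 2⁆
        + (128 : ℤ) • ⁅fgen 1, fgen 2⁆) - y) = 0 := by
    simp only [map_sub, LieHom.map_lie, map_add, map_smul, ripsMk_fgen]
    exact sub_eq_zero.2 hyα.symm
  have h1 := RM.relIdeal_le (ripsMk_zero.1 h0)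
  rw [LieIdeal.mem_comap] at h1
  simp only [map_sub, LieHom.map_lie, map_add, map_smul, RM.φ_fgen, hφ] at h1
  have h2 : RM.Cond _ := h1
  have h3 := h2.2.1
  simp only [RM.gen0, RM.gen1, RM.gen2, sub_eq_add_neg, RM.add_def, RM.neg_def, RM.zero_def,
    RM.smul_def, RM.lie_def] at h3
  revert h3
  decide

/-- The element `α = 32⁅e_0,e_1⁆ + 64⁅e_0,e_2⁆ + 128⁅e_1,e_2⁆` lies in `δ_4(A)` but
not in `γ_4(A)`. -/
theorem rips_lie_dimension_quotient :
    ((32 : ℤ) • ⁅egen 0, egen 1⁆ + (64 : ℤ) • ⁅egen 0, egen 2⁆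
        + (128 : ℤ) • ⁅egen 1, egen 2⁆) ∈ dimensionSubring RipsLie 4 ∧
    ((32 : ℤ) • ⁅egen 0, egen 1⁆ + (64 : ℤ) • ⁅egen 0, egen 2⁆
        + (128 : ℤ) • ⁅egen 1, egen 2⁆) ∉ gammaLie RipsLie 4 :=
  ⟨rips_mem_delta, rips_notMem_gamma⟩
end

section
/- Let k := 𝔽_2[x_0, x_1, x_2]/(x_0², x_1², x_2²) and let A be the Lie algebra over k obtained as the quotient of the free Lie k-algebra on e_0, e_1, e_2 by the Lie ideal generated by x_0·e_0 + x_1·e_1 + x_2·e_2. Then the element α := x_0x_1·⁅e_0, e_1⁆ + x_0x_2·⁅e_0, e_2⁆ + x_1x_2·⁅e_1, e_2⁆ is nonzero in A, but its image under the canonical map A → U(A) to the universal enveloping algebra is zero. In particular, the canonical map A → U(A) is not injective. -/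
/-- The base ring `k = 𝔽₂[x₀, x₁, x₂]/(x₀², x₁², x₂²)`. -/
def CartierRing : Type :=
  MvPolynomial (Fin 3) (ZMod 2) ⧸
    Ideal.span (Set.range fun i : Fin 3 => (MvPolynomial.X i : MvPolynomial (Fin 3) (ZMod 2)) ^ 2)

noncomputable instance : CommRing CartierRing :=
  Ideal.Quotient.commRing _

/-- The images `x₀, x₁, x₂` of the variables in `k`. -/
noncomputable def xvar (i : Fin 3) : CartierRing :=
  Ideal.Quotient.mk _ (MvPolynomial.X i)

/-- The generators `e₀, e₁, e₂` of the free Lie `k`-algebra. -/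
noncomputable def efree (i : Fin 3) : FreeLieAlgebra CartierRing (Fin 3) :=
  FreeLieAlgebra.of CartierRing i

/-- The Lie ideal generated by the relation `x₀·e₀ + x₁·e₁ + x₂·e₂`. -/
noncomputable def cartierIdeal : LieIdeal CartierRing (FreeLieAlgebra CartierRing (Fin 3)) :=
  LieSubmodule.lieSpan CartierRing (FreeLieAlgebra CartierRing (Fin 3))
    {xvar 0 • efree 0 + xvar 1 • efree 1 + xvar 2 • efree 2}

/-- Cartier's Lie algebra `A = ⟨e₀, e₁, e₂ ∣ x₀e₀ + x₁e₁ + x₂e₂ = 0⟩` over `k`. -/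
abbrev CartierLie : Type := FreeLieAlgebra CartierRing (Fin 3) ⧸ cartierIdeal

/-- The images of the generators in `A`. -/
noncomputable def eC (i : Fin 3) : CartierLie :=
  LieSubmodule.Quotient.mk' cartierIdeal (efree i)

theorem xvar_sq (i : Fin 3) : xvar i * xvar i = 0 := by
  unfold xvar
  refine (map_mul (Ideal.Quotient.mk _) _ _).symm.trans ?_
  refine Ideal.Quotient.eq_zero_iff_mem.2 ?_
  exact Ideal.subset_span ⟨i, by simp [pow_two]⟩

theorem cartier_two : (2 : CartierRing) = 0 := by
  refine (map_ofNat (Ideal.Quotient.mk (Ideal.span (Set.range fun i : Fin 3 =>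
    (MvPolynomial.X i : MvPolynomial (Fin 3) (ZMod 2)) ^ 2))) 2).symm.trans ?_
  have h : (2 : MvPolynomial (Fin 3) (ZMod 2)) = 0 := CharTwo.two_eq_zero
  refine Eq.trans (congrArg _ h) (map_zero _)

theorem xvar_prod : xvar 0 * xvar 1 * xvar 2 ≠ 0 := by
  intro h
  have h2 : (MvPolynomial.X 0 * MvPolynomial.X 1 * MvPolynomial.X 2 :
      MvPolynomial (Fin 3) (ZMod 2)) ∈ Ideal.span (Set.range fun i : Fin 3 =>
        (MvPolynomial.X i : MvPolynomial (Fin 3) (ZMod 2)) ^ 2) := by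
    apply Ideal.Quotient.eq_zero_iff_mem.1
    rw [map_mul, map_mul]
    exact h
  have e : (Set.range fun i : Fin 3 => (MvPolynomial.X i : MvPolynomial (Fin 3) (ZMod 2)) ^ 2)
      = (fun s => MvPolynomial.monomial s (1 : ZMod 2)) ''
        (Set.range fun i : Fin 3 => Finsupp.single i 2) := by
    rw [← Set.range_comp]
    congr 1
    funext i
    simp [MvPolynomial.X_pow_eq_monomial]
  rw [e, MvPolynomial.mem_ideal_span_monomial_image] at h2
  have e2 : (MvPolynomial.X 0 * MvPolynomial.X 1 * MvPolynomial.X 2 :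
      MvPolynomial (Fin 3) (ZMod 2)) = MvPolynomial.monomial
        (Finsupp.single 0 1 + Finsupp.single 1 1 + Finsupp.single 2 1) 1 := by
    simp [MvPolynomial.X, MvPolynomial.monomial_mul]
  obtain ⟨_, ⟨i, rfl⟩, hi⟩ := h2 (Finsupp.single 0 1 + Finsupp.single 1 1 + Finsupp.single 2 1)
    (by rw [e2, MvPolynomial.mem_support_iff, MvPolynomial.coeff_monomial]; simp)
  have := hi i
  fin_cases i <;> simp [Finsupp.single_apply] at this

/-- Auxiliary two-step nilpotent Lie algebra `k³ ⊕ k`. -/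
@[ext] structure HeisC where
  a : CartierRing
  b : CartierRing
  c : CartierRing
  z : CartierRing

namespace HeisC

noncomputable instance : Zero HeisC := ⟨⟨0, 0, 0, 0⟩⟩
noncomputable instance : Add HeisC := ⟨fun u v => ⟨u.a + v.a, u.b + v.b, u.c + v.c, u.z + v.z⟩⟩
noncomputable instance : Neg HeisC := ⟨fun u => ⟨-u.a, -u.b, -u.c, -u.z⟩⟩
noncomputable instance : SMul CartierRing HeisC := ⟨fun t u => ⟨t * u.a, t * u.b, t * u.c, t * u.z⟩⟩

/-- The determinant of `x, u, v`. -/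
noncomputable def det (u v : HeisC) : CartierRing :=
  xvar 0 * (u.b * v.c - u.c * v.b) - xvar 1 * (u.a * v.c - u.c * v.a)
    + xvar 2 * (u.a * v.b - u.b * v.a)

noncomputable instance : Bracket HeisC HeisC := ⟨fun u v => ⟨0, 0, 0, det u v⟩⟩

@[simp] theorem zero_a : (0 : HeisC).a = 0 := rfl
@[simp] theorem zero_b : (0 : HeisC).b = 0 := rfl
@[simp] theorem zero_c : (0 : HeisC).c = 0 := rfl
@[simp] theorem zero_z : (0 : HeisC).z = 0 := rfl
@[simp] theorem add_a (u v : HeisC) : (u + v).a = u.a + v.a := rfl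
@[simp] theorem add_b (u v : HeisC) : (u + v).b = u.b + v.b := rfl
@[simp] theorem add_c (u v : HeisC) : (u + v).c = u.c + v.c := rfl
@[simp] theorem add_z (u v : HeisC) : (u + v).z = u.z + v.z := rfl
@[simp] theorem neg_a (u : HeisC) : (-u).a = -u.a := rfl
@[simp] theorem neg_b (u : HeisC) : (-u).b = -u.b := rfl
@[simp] theorem neg_c (u : HeisC) : (-u).c = -u.c := rfl
@[simp] theorem neg_z (u : HeisC) : (-u).z = -u.z := rfl
@[simp] theorem smul_a (t : CartierRing) (u : HeisC) : (t • u).a = t * u.a := rfl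
@[simp] theorem smul_b (t : CartierRing) (u : HeisC) : (t • u).b = t * u.b := rfl
@[simp] theorem smul_c (t : CartierRing) (u : HeisC) : (t • u).c = t * u.c := rfl
@[simp] theorem smul_z (t : CartierRing) (u : HeisC) : (t • u).z = t * u.z := rfl
@[simp] theorem lie_a (u v : HeisC) : ⁅u, v⁆.a = 0 := rfl
@[simp] theorem lie_b (u v : HeisC) : ⁅u, v⁆.b = 0 := rfl
@[simp] theorem lie_c (u v : HeisC) : ⁅u, v⁆.c = 0 := rfl
@[simp] theorem lie_z (u v : HeisC) : ⁅u, v⁆.z = det u v := rfl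

noncomputable instance : AddCommGroup HeisC where
  add_assoc u v w := by ext <;> simp [add_assoc]
  zero_add u := by ext <;> simp
  add_zero u := by ext <;> simp
  add_comm u v := by ext <;> simp [add_comm]
  neg_add_cancel u := by ext <;> simp
  nsmul := nsmulRec
  zsmul := zsmulRec

noncomputable instance : Module CartierRing HeisC where
  one_smul u := by ext <;> simp
  mul_smul s t u := by ext <;> simp [mul_assoc]
  smul_zero t := by ext <;> simp
  smul_add t u v := by ext <;> simp [mul_add]
  add_smul s t u := by ext <;> simp [add_mul]
  zero_smul u := by ext <;> simp

noncomputable instance : LieRing HeisC where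
  add_lie u v w := by ext <;> simp [det]; ring
  lie_add u v w := by ext <;> simp [det]; ring
  lie_self u := by ext <;> simp [det]; ring
  leibniz_lie u v w := by ext <;> simp [det]

noncomputable instance : LieAlgebra CartierRing HeisC where
  lie_smul t u v := by ext <;> simp [det]; ring

/-- Elements with no central part that pair to zero with everything. -/
noncomputable def rad : LieIdeal CartierRing HeisC where
  carrier := {u | u.z = 0 ∧ ∀ v, det v u = 0}
  add_mem' := by
    rintro u v ⟨hu, hu'⟩ ⟨hv, hv'⟩
    refine ⟨by simp [hu, hv], fun w => ?_⟩
    have h : det w (u + v) = det w u + det w v := by simp [det]; ring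
    rw [h, hu', hv', add_zero]
  zero_mem' := ⟨rfl, fun v => by simp [det]⟩
  smul_mem' := by
    rintro t u ⟨hu, hu'⟩
    refine ⟨by simp [hu], fun w => ?_⟩
    have h : det w (t • u) = t * det w u := by simp [det]; ring
    rw [h, hu', mul_zero]
  lie_mem := by
    rintro w u ⟨_, hu'⟩
    exact ⟨hu' w, fun v => by simp [det]⟩

theorem mem_rad (u : HeisC) : u ∈ rad ↔ u.z = 0 ∧ ∀ v, det v u = 0 := Iff.rfl

/-- The images of the generators. -/
noncomputable def gen : Fin 3 → HeisC := ![⟨1, 0, 0, 0⟩, ⟨0, 1, 0, 0⟩, ⟨0, 0, 1, 0⟩]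

/-- The map from the free Lie algebra. -/
noncomputable def toH : FreeLieAlgebra CartierRing (Fin 3) →ₗ⁅CartierRing⁆ HeisC :=
  FreeLieAlgebra.lift CartierRing gen

theorem toH_e (i : Fin 3) : toH (efree i) = gen i := FreeLieAlgebra.lift_of_apply _ _

theorem ideal_le : cartierIdeal ≤ LieIdeal.comap toH rad := by
  unfold cartierIdeal
  rw [LieSubmodule.lieSpan_le, Set.singleton_subset_iff, SetLike.mem_coe, LieIdeal.mem_comap,
    mem_rad]
  simp only [map_add, map_smul, toH_e]
  refine ⟨by simp [gen], fun v => ?_⟩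
  simp [gen, det]
  ring

end HeisC

theorem cartier_ne : ((xvar 0 * xvar 1) • ⁅eC 0, eC 1⁆ + (xvar 0 * xvar 2) • ⁅eC 0, eC 2⁆
        + (xvar 1 * xvar 2) • ⁅eC 1, eC 2⁆) ≠ 0 := by
  intro h
  have h1 : (LieSubmodule.Quotient.mk ((xvar 0 * xvar 1) • ⁅efree 0, efree 1⁆
      + (xvar 0 * xvar 2) • ⁅efree 0, efree 2⁆
      + (xvar 1 * xvar 2) • ⁅efree 1, efree 2⁆) : CartierLie) = 0 := h
  rw [LieSubmodule.Quotient.mk_eq_zero'] at h1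
  have h2 := HeisC.ideal_le h1
  rw [LieIdeal.mem_comap, HeisC.mem_rad] at h2
  have h3 := h2.1
  simp only [map_smul, map_add, LieHom.map_lie, HeisC.toH_e] at h3
  simp [HeisC.gen, HeisC.det] at h3
  apply xvar_prod
  linear_combination h3 - (xvar 0 * xvar 1 * xvar 2 - xvar 0 * xvar 1 * xvar 2) * cartier_two

theorem cartier_rel : xvar 0 • eC 0 + xvar 1 • eC 1 + xvar 2 • eC 2 = 0 := by
  have : (LieSubmodule.Quotient.mk (xvar 0 • efree 0 + xvar 1 • efree 1 + xvar 2 • efree 2) :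
      CartierLie) = 0 := by
    rw [LieSubmodule.Quotient.mk_eq_zero']
    exact LieSubmodule.subset_lieSpan rfl
  exact this

theorem alg_aux {U : Type*} [Ring U] [Algebra CartierRing U] (p q r : U)
    (h : xvar 0 • p + xvar 1 • q + xvar 2 • r = 0) :
    (xvar 0 * xvar 1) • (p * q - q * p) + (xvar 0 * xvar 2) • (p * r - r * p)
      + (xvar 1 * xvar 2) • (q * r - r * q) = 0 := by
  have neg' : ∀ u : U, -u = u := fun u => by
    have : (2 : CartierRing) • u = 0 := by rw [cartier_two, zero_smul]
    rw [two_smul] at this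
    exact neg_eq_of_add_eq_zero_left this
  have hs : (xvar 0 • p + xvar 1 • q + xvar 2 • r) * (xvar 0 • p + xvar 1 • q + xvar 2 • r) = 0 := by
    rw [h, zero_mul]
  simp only [add_mul, mul_add, smul_mul_assoc, mul_smul_comm, smul_add, smul_smul, xvar_sq, zero_smul] at hs
  simp only [sub_eq_add_neg, neg']
  rw [← hs, mul_comm (xvar 1) (xvar 0), mul_comm (xvar 2) (xvar 0), mul_comm (xvar 2) (xvar 1)]
  simp only [smul_add]
  abel

theorem cartier_zero : UniversalEnvelopingAlgebra.ι CartierRing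
      ((xvar 0 * xvar 1) • ⁅eC 0, eC 1⁆ + (xvar 0 * xvar 2) • ⁅eC 0, eC 2⁆
        + (xvar 1 * xvar 2) • ⁅eC 1, eC 2⁆) = 0 := by
  have h := congrArg (UniversalEnvelopingAlgebra.ι CartierRing) cartier_rel
  simp only [map_smul, map_add, map_zero] at h
  simp only [map_smul, map_add, LieHom.map_lie, LieRing.of_associative_ring_bracket]
  exact alg_aux _ _ _ h

/-- The element `α = x₀x₁⁅e₀,e₁⁆ + x₀x₂⁅e₀,e₂⁆ + x₁x₂⁅e₁,e₂⁆` is nonzero in `A`, but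
its image in the universal enveloping algebra `U(A)` is zero; in particular the
canonical map `A → U(A)` is not injective. -/
theorem cartier_not_injective :
    ((xvar 0 * xvar 1) • ⁅eC 0, eC 1⁆ + (xvar 0 * xvar 2) • ⁅eC 0, eC 2⁆
        + (xvar 1 * xvar 2) • ⁅eC 1, eC 2⁆) ≠ 0 ∧
    UniversalEnvelopingAlgebra.ι CartierRing
      ((xvar 0 * xvar 1) • ⁅eC 0, eC 1⁆ + (xvar 0 * xvar 2) • ⁅eC 0, eC 2⁆
        + (xvar 1 * xvar 2) • ⁅eC 1, eC 2⁆) = 0 ∧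
    ¬ Function.Injective
        (UniversalEnvelopingAlgebra.ι CartierRing :
          CartierLie → UniversalEnvelopingAlgebra CartierRing CartierLie) := by
  exact ⟨cartier_ne, cartier_zero, fun hi => cartier_ne (hi (cartier_zero.trans (map_zero _).symm))⟩
end
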